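/- arXiv:2503.20573 — 9 statements merged into one kernel-verified Lean document; each statement's English description precedes it below -/
import Mathlib

section
/- Let 𝔪 ∈ ℝ^d, let Σ be a symmetric positive definite d×d real matrix, let β, σ > 0, a ∈ ℝ, and b ∈ ℝ^d. Set A := σ I_d + β² Σ. Then for every x ∈ ℝ^d, the ℝ^d-valued Lebesgue integral ∫_{ℝ^d} (a y + b) φ_σ(x − β y) 𝒩(y | 𝔪, Σ) dy equals 𝒩(x | β𝔪, A) · ( a A^{−1}(β Σ x + σ 𝔪) + b ). -/
open MeasureTheory Matrix
open scoped ENNReal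

section MulVecChangeOfVariables

variable {ι : Type*} [Fintype ι] [DecidableEq ι] {B : Matrix ι ι ℝ}

theorem measurableEmbedding_toLin'_of_det_ne_zero (hB : B.det ≠ 0) :
    MeasurableEmbedding (toLin' B) := by
  have hdet : LinearMap.det (toLin' B) ≠ 0 := by rwa [LinearMap.det_toLin']
  exact (LinearMap.equivOfDetNeZero (toLin' B)
    hdet).toContinuousLinearEquiv.toHomeomorph.measurableEmbedding

variable {E : Type*} [NormedAddCommGroup E] {F : (ι → ℝ) → E}

theorem MeasureTheory.Integrable.comp_mulVec (hF : Integrable F) (hB : B.det ≠ 0) :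
    Integrable fun y => F (B *ᵥ y) := by
  have h := (measurableEmbedding_toLin'_of_det_ne_zero hB).integrable_map_iff
    (μ := volume) (g := F)
  rw [Real.map_matrix_volume_pi_eq_smul_volume_pi hB] at h
  exact h.mp (hF.smul_measure ENNReal.ofReal_ne_top)

theorem integral_comp_mulVec [NormedSpace ℝ E] (F : (ι → ℝ) → E) (hB : B.det ≠ 0) :
    ∫ y, F (B *ᵥ y) = |B.det⁻¹| • ∫ z, F z := by
  have h := (measurableEmbedding_toLin'_of_det_ne_zero hB).integral_map (μ := volume) F
  rw [Real.map_matrix_volume_pi_eq_smul_volume_pi hB, integral_smul_measure,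
    ENNReal.toReal_ofReal (abs_nonneg _)] at h
  simpa using h.symm

end MulVecChangeOfVariables

section StandardGaussian

variable {ι : Type*} [Fintype ι]

theorem exp_neg_dotProduct_self_div_two (z : ι → ℝ) :
    Real.exp (-(z ⬝ᵥ z) / 2) = ∏ i, Real.exp (-(1 / 2) * z i ^ 2) := by
  rw [← Real.exp_sum, ← Finset.mul_sum]
  congr 1
  simp only [dotProduct, pow_two]
  ring

theorem integrable_exp_neg_dotProduct_self_div_two :
    Integrable fun z : ι → ℝ => Real.exp (-(z ⬝ᵥ z) / 2) := by
  simp_rw [exp_neg_dotProduct_self_div_two]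
  exact Integrable.fintype_prod fun _ => integrable_exp_neg_mul_sq (by norm_num)

theorem integral_exp_neg_dotProduct_self_div_two :
    ∫ z : ι → ℝ, Real.exp (-(z ⬝ᵥ z) / 2) = √((2 * Real.pi) ^ Fintype.card ι) := by
  simp_rw [exp_neg_dotProduct_self_div_two]
  rw [integral_fintype_prod_volume_eq_pow fun t : ℝ => Real.exp (-(1 / 2) * t ^ 2),
    integral_gaussian, Real.sqrt_eq_rpow, Real.sqrt_eq_rpow, ← Real.rpow_natCast,
    ← Real.rpow_natCast, ← Real.rpow_mul (by positivity), ← Real.rpow_mul (by positivity)]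
  congr 1 <;> ring

theorem integrable_exp_neg_dotProduct_self_div_two_smul :
    Integrable fun z : ι → ℝ => Real.exp (-(z ⬝ᵥ z) / 2) • z := by
  classical
  refine Integrable.of_eval fun i => ?_
  have h : (fun z : ι → ℝ => (Real.exp (-(z ⬝ᵥ z) / 2) • z) i) = fun z =>
      ∏ j, (if j = i then (fun t : ℝ => t * Real.exp (-(1 / 2) * t ^ 2))
        else fun t => Real.exp (-(1 / 2) * t ^ 2)) (z j) := by
    ext z
    have hj : ∀ j, (if j = i then (fun t : ℝ => t * Real.exp (-(1 / 2) * t ^ 2))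
        else fun t => Real.exp (-(1 / 2) * t ^ 2)) (z j)
        = (if j = i then z j else 1) * Real.exp (-(1 / 2) * z j ^ 2) := by
      intro j
      split_ifs <;> simp
    simp_rw [hj, Finset.prod_mul_distrib, ← exp_neg_dotProduct_self_div_two]
    simp [mul_comm]
  rw [h]
  refine Integrable.fintype_prod fun j => ?_
  split_ifs
  · exact integrable_mul_exp_neg_mul_sq (by norm_num)
  · exact integrable_exp_neg_mul_sq (by norm_num)

end StandardGaussian

section GaussianPrecision

variable {ι : Type*} [Fintype ι]

theorem transpose_mul_self_mulVec_dotProduct_self (B : Matrix ι ι ℝ) (z : ι → ℝ) :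
    ((Bᵀ * B) *ᵥ z) ⬝ᵥ z = (B *ᵥ z) ⬝ᵥ (B *ᵥ z) := by
  rw [← mulVec_mulVec, mulVec_transpose, ← dotProduct_mulVec]

theorem integral_exp_neg_quadratic_smul (P : Matrix ι ι ℝ) :
    ∫ z : ι → ℝ, Real.exp (-((P *ᵥ z) ⬝ᵥ z) / 2) • z = 0 := by
  have h := integral_neg_eq_self (fun z : ι → ℝ => Real.exp (-((P *ᵥ z) ⬝ᵥ z) / 2) • z) volume
  simp only [mulVec_neg, neg_dotProduct, dotProduct_neg, neg_neg, smul_neg, integral_neg] at h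
  exact neg_eq_self.mp h

variable [DecidableEq ι] {P : Matrix ι ι ℝ}

open scoped MatrixOrder Matrix.Norms.L2Operator in
theorem Matrix.PosDef.exists_transpose_mul_self (hP : P.PosDef) :
    ∃ B : Matrix ι ι ℝ, B.det ≠ 0 ∧ P = Bᵀ * B := by
  obtain ⟨B, hB⟩ := CStarAlgebra.nonneg_iff_eq_star_mul_self.mp hP.posSemidef.nonneg
  have hB' : P = Bᵀ * B := by rw [hB, star_eq_conjTranspose, conjTranspose_eq_transpose_of_trivial]
  refine ⟨B, fun h => hP.det_pos.ne' ?_, hB'⟩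
  rw [hB', det_mul, h, mul_zero]

theorem integrable_exp_neg_quadratic (hP : P.PosDef) :
    Integrable fun z : ι → ℝ => Real.exp (-((P *ᵥ z) ⬝ᵥ z) / 2) := by
  obtain ⟨B, hB, rfl⟩ := hP.exists_transpose_mul_self
  simp_rw [transpose_mul_self_mulVec_dotProduct_self]
  exact integrable_exp_neg_dotProduct_self_div_two.comp_mulVec hB

theorem integral_exp_neg_quadratic (hP : P.PosDef) :
    ∫ z : ι → ℝ, Real.exp (-((P *ᵥ z) ⬝ᵥ z) / 2)
      = √((2 * Real.pi) ^ Fintype.card ι / P.det) := by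
  obtain ⟨B, hB, rfl⟩ := hP.exists_transpose_mul_self
  simp_rw [transpose_mul_self_mulVec_dotProduct_self]
  rw [integral_comp_mulVec (fun z => Real.exp (-(z ⬝ᵥ z) / 2)) hB,
    integral_exp_neg_dotProduct_self_div_two, det_mul, det_transpose,
    Real.sqrt_div (by positivity), Real.sqrt_mul_self_eq_abs, abs_inv, smul_eq_mul, div_eq_inv_mul]

theorem integrable_exp_neg_quadratic_smul (hP : P.PosDef) :
    Integrable fun z : ι → ℝ => Real.exp (-((P *ᵥ z) ⬝ᵥ z) / 2) • z := by
  obtain ⟨B, hB, rfl⟩ := hP.exists_transpose_mul_self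
  simp_rw [transpose_mul_self_mulVec_dotProduct_self]
  have h := (toLin' B⁻¹).toContinuousLinearMap.integrable_comp
    (integrable_exp_neg_dotProduct_self_div_two_smul.comp_mulVec hB)
  refine h.congr (.of_forall fun z => ?_)
  simp [mulVec_mulVec, nonsing_inv_mul B (isUnit_iff_ne_zero.mpr hB)]

theorem integral_exp_neg_quadratic_smul_affine (hP : P.PosDef) (c : ι → ℝ) (a : ℝ) (b : ι → ℝ) :
    ∫ y : ι → ℝ, Real.exp (-((P *ᵥ (y - c)) ⬝ᵥ (y - c)) / 2) • (a • y + b)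
      = √((2 * Real.pi) ^ Fintype.card ι / P.det) • (a • c + b) := by
  rw [← integral_add_right_eq_self _ c]
  have h : ∀ z : ι → ℝ, Real.exp (-((P *ᵥ (z + c - c)) ⬝ᵥ (z + c - c)) / 2) • (a • (z + c) + b)
      = a • (Real.exp (-((P *ᵥ z) ⬝ᵥ z) / 2) • z)
        + Real.exp (-((P *ᵥ z) ⬝ᵥ z) / 2) • (a • c + b) := by
    intro z
    rw [add_sub_cancel_right]
    module
  simp_rw [h]
  have hi : Integrable fun z : ι → ℝ => a • (Real.exp (-((P *ᵥ z) ⬝ᵥ z) / 2) • z) :=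
    (integrable_exp_neg_quadratic_smul hP).smul a
  rw [integral_add hi ((integrable_exp_neg_quadratic hP).smul_const _), integral_smul,
    integral_exp_neg_quadratic_smul, smul_zero, zero_add, integral_smul_const,
    integral_exp_neg_quadratic hP]

end GaussianPrecision

section CompletingTheSquare

variable {ι : Type*} [Fintype ι] [DecidableEq ι] {S A : Matrix ι ι ℝ} {β σ : ℝ}

theorem smul_posterior_precision_mul (hS : S.PosDef) (hσ : 0 < σ)
    (hA : A = σ • (1 : Matrix ι ι ℝ) + β ^ 2 • S) :
    σ • ((S⁻¹ + (β ^ 2 / σ) • (1 : Matrix ι ι ℝ)) * S) = A := by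
  rw [add_mul, nonsing_inv_mul S hS.det_pos.ne'.isUnit, smul_mul_assoc, one_mul, smul_add,
    smul_smul, mul_div_cancel₀ _ hσ.ne', hA]

theorem posterior_mean_eq (hA : A = σ • (1 : Matrix ι ι ℝ) + β ^ 2 • S) (hdet : IsUnit A.det)
    (m x w : ι → ℝ) (hx : x = β • m + A *ᵥ w) :
    A⁻¹ *ᵥ (β • (S *ᵥ x) + σ • m) = m + β • (S *ᵥ w) := by
  have hcomm : S * A = A * S := by simp [hA, mul_add, add_mul]
  have h : β • (S *ᵥ x) + σ • m = A *ᵥ (m + β • (S *ᵥ w)) := by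
    rw [hx]
    simp only [mulVec_add, mulVec_smul, mulVec_mulVec, hcomm]
    rw [show A *ᵥ m = σ • m + β ^ 2 • (S *ᵥ m) by simp [hA, add_mulVec, smul_mulVec]]
    module
  rw [h, mulVec_mulVec, nonsing_inv_mul A hdet, one_mulVec]

theorem quadratic_add_eq_posterior_quadratic_add (hS : S.PosDef) (hσ : 0 < σ)
    (hA : A = σ • (1 : Matrix ι ι ℝ) + β ^ 2 • S) (m w z : ι → ℝ) :
    ((β • m + A *ᵥ w) - β • (m + β • (S *ᵥ w) + z))
          ⬝ᵥ ((β • m + A *ᵥ w) - β • (m + β • (S *ᵥ w) + z)) / σ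
        + (S⁻¹ *ᵥ ((m + β • (S *ᵥ w) + z) - m)) ⬝ᵥ ((m + β • (S *ᵥ w) + z) - m)
      = ((S⁻¹ + (β ^ 2 / σ) • (1 : Matrix ι ι ℝ)) *ᵥ z) ⬝ᵥ z + w ⬝ᵥ (A *ᵥ w) := by
  have hAw : A *ᵥ w = σ • w + β ^ 2 • (S *ᵥ w) := by simp [hA, add_mulVec, smul_mulVec]
  have h₁ : (β • m + A *ᵥ w) - β • (m + β • (S *ᵥ w) + z) = σ • w - β • z := by
    rw [hAw]
    module
  have h₂ : (m + β • (S *ᵥ w) + z) - m = β • (S *ᵥ w) + z := by abel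
  have h₃ : S⁻¹ *ᵥ (β • (S *ᵥ w) + z) = β • w + S⁻¹ *ᵥ z := by
    rw [mulVec_add, mulVec_smul, mulVec_mulVec, nonsing_inv_mul S hS.det_pos.ne'.isUnit,
      one_mulVec]
  have hT : Sᵀ = S := by simpa using hS.isHermitian.eq
  have h₄ : (S⁻¹ *ᵥ z) ⬝ᵥ (S *ᵥ w) = w ⬝ᵥ z := by
    rw [dotProduct_mulVec, ← mulVec_transpose, hT, mulVec_mulVec,
      mul_nonsing_inv S hS.det_pos.ne'.isUnit, one_mulVec, dotProduct_comm]
  rw [h₁, h₂, h₃, hAw]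
  simp only [add_mulVec, smul_mulVec, one_mulVec, dotProduct_add, add_dotProduct,
    dotProduct_sub, sub_dotProduct, dotProduct_smul, smul_dotProduct, smul_eq_mul, h₄,
    dotProduct_comm z w]
  field_simp
  ring

end CompletingTheSquare

/-- Gaussian integral identity (Lemma 8.1 of the paper).  For `𝔪 ∈ ℝ^d`, a symmetric
positive definite matrix `Σ`, `β, σ > 0`, `a ∈ ℝ`, `b ∈ ℝ^d` and `A = σ I + β² Σ`,
`∫ (a y + b) φ_σ(x − β y) 𝒩(y | 𝔪, Σ) dy = 𝒩(x | β𝔪, A) (a A⁻¹(β Σ x + σ 𝔪) + b)`. -/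
theorem gaussian_moment_identity
    {d : ℕ} (𝔪 : Fin d → ℝ) (S : Matrix (Fin d) (Fin d) ℝ) (hS : S.PosDef)
    (β σ : ℝ) (hβ : 0 < β) (hσ : 0 < σ) (a : ℝ) (b : Fin d → ℝ)
    (A : Matrix (Fin d) (Fin d) ℝ) (hA : A = σ • (1 : Matrix (Fin d) (Fin d) ℝ) + β ^ 2 • S)
    (x : Fin d → ℝ) :
    (∫ y : Fin d → ℝ,
        (((2 * Real.pi * σ) ^ (-(d : ℝ) / 2)
            * Real.exp (-((x - β • y) ⬝ᵥ (x - β • y)) / (2 * σ)))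
          * (Real.exp (-(S⁻¹.mulVec (y - 𝔪) ⬝ᵥ (y - 𝔪)) / 2)
              / Real.sqrt ((2 * Real.pi) ^ d * S.det)))
          • (a • y + b) ∂volume)
      = (Real.exp (-(A⁻¹.mulVec (x - β • 𝔪) ⬝ᵥ (x - β • 𝔪)) / 2)
            / Real.sqrt ((2 * Real.pi) ^ d * A.det))
          • (a • A⁻¹.mulVec (β • S.mulVec x + σ • 𝔪) + b) := by
  have hApd : A.PosDef := by
    rw [hA]
    exact (PosDef.one.smul hσ).add (hS.smul (by positivity))
  have hAu : IsUnit A.det := hApd.det_pos.ne'.isUnit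
  set P : Matrix (Fin d) (Fin d) ℝ := S⁻¹ + (β ^ 2 / σ) • 1 with hP_def
  have hP : P.PosDef := hS.inv.add (PosDef.one.smul (by positivity))
  have hdet : A.det = σ ^ d * (P.det * S.det) := by
    rw [← smul_posterior_precision_mul hS hσ hA, det_smul, det_mul, Fintype.card_fin]
  obtain ⟨w, hw⟩ : ∃ w, w = A⁻¹ *ᵥ (x - β • 𝔪) := ⟨_, rfl⟩
  have hAw : A *ᵥ w = x - β • 𝔪 := by
    rw [hw, mulVec_mulVec, mul_nonsing_inv A hAu, one_mulVec]
  have hx : x = β • 𝔪 + A *ᵥ w := by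
    rw [hAw]
    abel
  rw [posterior_mean_eq hA hAu 𝔪 x w hx, ← hw, ← hAw]
  set c : Fin d → ℝ := 𝔪 + β • (S *ᵥ w) with hc
  set K : ℝ := (2 * Real.pi * σ) ^ (-(d : ℝ) / 2) / √((2 * Real.pi) ^ d * S.det)
    * Real.exp (-(w ⬝ᵥ (A *ᵥ w)) / 2) with hK
  have hintegrand : ∀ y : Fin d → ℝ,
      (((2 * Real.pi * σ) ^ (-(d : ℝ) / 2)
            * Real.exp (-((x - β • y) ⬝ᵥ (x - β • y)) / (2 * σ)))
          * (Real.exp (-(S⁻¹.mulVec (y - 𝔪) ⬝ᵥ (y - 𝔪)) / 2)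
              / √((2 * Real.pi) ^ d * S.det))) • (a • y + b)
        = K • (Real.exp (-((P *ᵥ (y - c)) ⬝ᵥ (y - c)) / 2) • (a • y + b)) := by
    intro y
    have hq := quadratic_add_eq_posterior_quadratic_add hS hσ hA 𝔪 w (y - c)
    rw [← hc, add_sub_cancel c y, ← hx, ← hP_def] at hq
    have hexp : Real.exp (-((x - β • y) ⬝ᵥ (x - β • y)) / (2 * σ))
          * Real.exp (-(S⁻¹.mulVec (y - 𝔪) ⬝ᵥ (y - 𝔪)) / 2)
        = Real.exp (-(w ⬝ᵥ (A *ᵥ w)) / 2)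
          * Real.exp (-((P *ᵥ (y - c)) ⬝ᵥ (y - c)) / 2) := by
      rw [← Real.exp_add, ← Real.exp_add]
      congr 1
      rw [neg_div, mul_comm 2 σ, ← div_div]
      linarith
    rw [smul_smul]
    congr 1
    rw [hK]
    linear_combination
      (2 * Real.pi * σ) ^ (-(d : ℝ) / 2) / √((2 * Real.pi) ^ d * S.det) * hexp
  simp_rw [hintegrand]
  rw [integral_smul, integral_exp_neg_quadratic_smul_affine hP c a b, smul_smul, Fintype.card_fin]
  congr 1
  have hφ : (2 * Real.pi * σ) ^ (-(d : ℝ) / 2) = (√((2 * Real.pi * σ) ^ d))⁻¹ := by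
    rw [Real.sqrt_eq_rpow, ← Real.rpow_natCast, ← Real.rpow_mul (by positivity),
      ← Real.rpow_neg (by positivity)]
    congr 1
    ring
  have hnorm : (√((2 * Real.pi * σ) ^ d))⁻¹ / √((2 * Real.pi) ^ d * S.det)
      * √((2 * Real.pi) ^ d / P.det) = (√((2 * Real.pi) ^ d * A.det))⁻¹ := by
    have hSd := hS.det_pos
    have hPd := hP.det_pos
    rw [← Real.sqrt_inv, ← Real.sqrt_div (by positivity), ← Real.sqrt_mul (by positivity),
      ← Real.sqrt_inv, hdet, mul_pow]
    congr 1
    field_simp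
  rw [hK, hφ, dotProduct_comm w (A *ᵥ w), div_eq_mul_inv (Real.exp _), ← hnorm]
  ring
end

section
/- Let K > 0, let η and ξ₀ be independent random vectors in ℝ^d with |η| ≤ K almost surely, let ε > 0 and β, σ ∈ (0,1). Define D(x) := 𝔼[η e^{−|x − βη − σξ₀|²/(2εβσ)}] / 𝔼[e^{−|x − βη − σξ₀|²/(2εβσ)}] for x ∈ ℝ^d. Then |D(x)| ≤ K for all x ∈ ℝ^d. Moreover, if ξ₀ = x₀ is deterministic (a fixed point of ℝ^d), then D is differentiable on ℝ^d and its derivative satisfies the operator-norm bound ‖∇D(x)‖ ≤ 2K²/(εσ) for all x ∈ ℝ^d. -/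
open MeasureTheory ProbabilityTheory
open scoped ENNReal

/-- A weighted integral of a vector-valued function bounded by `C` is bounded by `C` times the
total weight. -/
theorem norm_integral_smul_le_mul_integral {Ω F : Type*} [MeasurableSpace Ω] {P : Measure Ω}
    [NormedAddCommGroup F] [NormedSpace ℝ F] {w : Ω → ℝ} {f : Ω → F} {C : ℝ}
    (hw : Integrable w P) (hw0 : ∀ ω, 0 ≤ w ω) (hf : ∀ᵐ ω ∂P, ‖f ω‖ ≤ C) :
    ‖∫ ω, w ω • f ω ∂P‖ ≤ C * ∫ ω, w ω ∂P := by
  rw [← integral_const_mul]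
  refine norm_integral_le_of_norm_le (hw.const_mul C) ?_
  filter_upwards [hf] with ω h
  rw [norm_smul, Real.norm_of_nonneg (hw0 ω), mul_comm]
  exact mul_le_mul_of_nonneg_right h (hw0 ω)

section ExponentialTilting

variable {Ω E F : Type*} [MeasurableSpace Ω] {P : Measure Ω}
  [NormedAddCommGroup E] [InnerProductSpace ℝ E] [NormedAddCommGroup F] [NormedSpace ℝ F]
  {g : Ω → ℝ} {η : Ω → E} {f : Ω → F} {K C : ℝ}

theorem exp_mul_inner_le {u y : E} (a : ℝ) {R : ℝ} (hu : ‖u‖ ≤ K) (hy : ‖y‖ ≤ R) :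
    Real.exp (a * inner ℝ u y) ≤ Real.exp (|a| * (K * R)) := by
  refine Real.exp_le_exp.2 ((le_abs_self _).trans ?_)
  rw [abs_mul]
  have hK : 0 ≤ K := (norm_nonneg _).trans hu
  refine mul_le_mul_of_nonneg_left ((abs_real_inner_le_norm u y).trans ?_) (abs_nonneg a)
  gcongr

theorem norm_smulRight_innerSL_le {u : E} {v : F} (a : ℝ) (hu : ‖u‖ ≤ K) (hv : ‖v‖ ≤ C) :
    ‖(a • innerSL ℝ u).smulRight v‖ ≤ |a| * K * C := by
  have hK : 0 ≤ K := (norm_nonneg _).trans hu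
  rw [ContinuousLinearMap.norm_smulRight_apply, norm_smul, innerSL_apply_norm, Real.norm_eq_abs]
  gcongr

theorem integrable_mul_exp_inner (hg : Integrable g P)
    (hη : AEStronglyMeasurable η P) (hηK : ∀ᵐ ω ∂P, ‖η ω‖ ≤ K) (a : ℝ) (y : E) :
    Integrable (fun ω => g ω * Real.exp (a * inner ℝ (η ω) y)) P := by
  refine hg.mul_bdd (c := Real.exp (|a| * (K * ‖y‖))) ?_ ?_
  · exact Real.continuous_exp.comp_aestronglyMeasurable
      ((hη.inner aestronglyMeasurable_const).const_mul a)
  · filter_upwards [hηK] with ω h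
    rw [Real.norm_of_nonneg (Real.exp_pos _).le]
    exact exp_mul_inner_le a h le_rfl

/-- Differentiation under the integral sign for exponentially tilted integrals. -/
theorem hasFDerivAt_integral_mul_exp_inner_smul (hg : Integrable g P) (hg0 : ∀ ω, 0 ≤ g ω)
    (hη : AEStronglyMeasurable η P) (hηK : ∀ᵐ ω ∂P, ‖η ω‖ ≤ K)
    (hf : AEStronglyMeasurable f P) (hfC : ∀ᵐ ω ∂P, ‖f ω‖ ≤ C) (a : ℝ) (y : E) :
    HasFDerivAt (fun y => ∫ ω, (g ω * Real.exp (a * inner ℝ (η ω) y)) • f ω ∂P)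
      (∫ ω, (g ω * Real.exp (a * inner ℝ (η ω) y)) •
        (a • innerSL ℝ (η ω)).smulRight (f ω) ∂P) y := by
  have hw := fun y => integrable_mul_exp_inner hg hη hηK a y
  refine hasFDerivAt_integral_of_dominated_of_fderiv_le
    (F' := fun y ω => (g ω * Real.exp (a * inner ℝ (η ω) y)) •
      (a • innerSL ℝ (η ω)).smulRight (f ω))
    (bound := fun ω => g ω * Real.exp (|a| * (K * (‖y‖ + 1))) * (|a| * K * C))
    (Metric.ball_mem_nhds y one_pos) (.of_forall fun z => (hw z).1.smul hf)
    ((hw y).smul_bdd C hf hfC) ((hw y).1.smul ?_) ?_ ?_ ?_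
  · have hL : AEStronglyMeasurable (fun ω => a • innerSL ℝ (η ω)) P :=
      ((innerSL ℝ).continuous.comp_aestronglyMeasurable hη).const_smul a
    exact (ContinuousLinearMap.smulRightL ℝ E F).aestronglyMeasurable_comp₂ hL hf
  · filter_upwards [hηK, hfC] with ω hu hv z hz
    have hzR : ‖z‖ ≤ ‖y‖ + 1 := by
      have := norm_le_norm_add_norm_sub' z y
      have := mem_ball_iff_norm.1 hz
      linarith
    rw [norm_smul, Real.norm_of_nonneg (mul_nonneg (hg0 ω) (Real.exp_pos _).le)]
    exact mul_le_mul (mul_le_mul_of_nonneg_left (exp_mul_inner_le a hu hzR) (hg0 ω))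
      (norm_smulRight_innerSL_le a hu hv) (norm_nonneg _)
      (mul_nonneg (hg0 ω) (Real.exp_pos _).le)
  · exact (hg.mul_const _).mul_const _
  · refine .of_forall fun ω z _ => ?_
    have h := ((((innerSL ℝ (η ω)).hasFDerivAt (x := z)).const_mul a).exp.const_mul
      (g ω)).smul_const (f ω)
    refine h.congr_fderiv ?_
    ext v
    simp [smul_smul, mul_assoc]

/-- The mean of `η` under the exponentially tilted weight is differentiable in the tilting
parameter, with derivative controlled by the bound on `η`. -/
theorem exists_hasFDerivAt_tiltedMean_norm_le [NeZero P] (hg : Integrable g P)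
    (hg0 : ∀ ω, 0 < g ω) (hη : AEStronglyMeasurable η P) (hηK : ∀ᵐ ω ∂P, ‖η ω‖ ≤ K)
    {a : ℝ} (ha : 0 ≤ a) (y : E) :
    ∃ A : E →L[ℝ] E, HasFDerivAt (fun y => (∫ ω, g ω * Real.exp (a * inner ℝ (η ω) y) ∂P)⁻¹ •
        ∫ ω, (g ω * Real.exp (a * inner ℝ (η ω) y)) • η ω ∂P) A y ∧ ‖A‖ ≤ 2 * K ^ 2 * a := by
  have hg0' := fun ω => (hg0 ω).le
  have hK : 0 ≤ K := by
    obtain ⟨ω, h⟩ := hηK.exists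
    exact (norm_nonneg _).trans h
  have hw := integrable_mul_exp_inner hg hη hηK a y
  have hwpos : ∀ ω, 0 < g ω * Real.exp (a * inner ℝ (η ω) y) :=
    fun ω => mul_pos (hg0 ω) (Real.exp_pos _)
  have hw0 := fun ω => (hwpos ω).le
  have hZ : 0 < ∫ ω, g ω * Real.exp (a * inner ℝ (η ω) y) ∂P := by
    rw [integral_pos_iff_support_of_nonneg hw0 hw,
      Function.support_eq_univ fun ω => (hwpos ω).ne']
    simp [NeZero.ne P]
  have hone : ∀ᵐ _ : Ω ∂P, ‖(1 : ℝ)‖ ≤ 1 := .of_forall fun _ => by simp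
  have hdZ := hasFDerivAt_integral_mul_exp_inner_smul hg hg0' hη hηK
    (f := fun _ => (1 : ℝ)) aestronglyMeasurable_const hone a y
  have hdN := hasFDerivAt_integral_mul_exp_inner_smul hg hg0' hη hηK hη hηK a y
  have hbZ := norm_integral_smul_le_mul_integral hw hw0
    (f := fun ω => (a • innerSL ℝ (η ω)).smulRight (1 : ℝ)) (C := |a| * K * 1)
    (hηK.mono fun ω h => norm_smulRight_innerSL_le a h (by simp))
  have hbN := norm_integral_smul_le_mul_integral hw hw0
    (f := fun ω => (a • innerSL ℝ (η ω)).smulRight (η ω)) (C := |a| * K * K)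
    (hηK.mono fun ω h => norm_smulRight_innerSL_le a h h)
  have hN := norm_integral_smul_le_mul_integral hw hw0 hηK
  simp only [smul_eq_mul, mul_one] at hdZ hbZ
  rw [abs_of_nonneg ha] at hbZ hbN
  have hd := ((hasDerivAt_inv hZ.ne').comp_hasFDerivAt y hdZ).smul hdN
  refine ⟨_, hd, ?_⟩
  simp only [Function.comp_apply]
  generalize (∫ ω, g ω * Real.exp (a * inner ℝ (η ω) y) ∂P) = Z at *
  generalize (∫ ω, (g ω * Real.exp (a * inner ℝ (η ω) y)) • η ω ∂P) = N at *
  refine (norm_add_le _ _).trans ?_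
  rw [norm_smul, ContinuousLinearMap.norm_smulRight_apply, norm_smul, norm_neg, norm_inv,
    norm_inv, norm_pow, Real.norm_of_nonneg hZ.le]
  calc _ ≤ Z⁻¹ * (a * K * K * Z) + (Z ^ 2)⁻¹ * (a * K * Z) * (K * Z) := by gcongr
    _ = 2 * K ^ 2 * a := by field_simp; ring

end ExponentialTilting

/-- Bounds on the conditional-mean drift component
`D(x) = 𝔼[η e^{−|x−βη−σξ₀|²/(2εβσ)}] / 𝔼[e^{−|x−βη−σξ₀|²/(2εβσ)}]` for independent `η, ξ₀`
with `|η| ≤ K` a.s.: `|D(x)| ≤ K` everywhere; moreover, if `ξ₀ ≡ x₀` is deterministic then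
`D` is differentiable with `‖∇D(x)‖ ≤ 2K²/(εσ)`. -/
theorem drift_D_bounds
    {d : ℕ} {Ω : Type*} [MeasurableSpace Ω] (P : Measure Ω) [IsProbabilityMeasure P]
    (K : ℝ) (hK : 0 < K)
    (η ξ₀ : Ω → EuclideanSpace ℝ (Fin d)) (hη : Measurable η) (hξ₀ : Measurable ξ₀)
    (hindep : IndepFun η ξ₀ P) (hbdd : ∀ᵐ ω ∂P, ‖η ω‖ ≤ K)
    (ε β σ : ℝ) (hε : 0 < ε) (hβ : β ∈ Set.Ioo (0 : ℝ) 1) (hσ : σ ∈ Set.Ioo (0 : ℝ) 1)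
    (D : EuclideanSpace ℝ (Fin d) → EuclideanSpace ℝ (Fin d))
    (hD : ∀ x, D x =
      (∫ ω, Real.exp (-‖x - β • η ω - σ • ξ₀ ω‖ ^ 2 / (2 * ε * β * σ)) ∂P)⁻¹
        • ∫ ω, Real.exp (-‖x - β • η ω - σ • ξ₀ ω‖ ^ 2 / (2 * ε * β * σ)) • η ω ∂P) :
    (∀ x, ‖D x‖ ≤ K) ∧
      (∀ x₀ : EuclideanSpace ℝ (Fin d), (∀ ω, ξ₀ ω = x₀) →
        ∀ x, DifferentiableAt ℝ D x ∧ ‖fderiv ℝ D x‖ ≤ 2 * K ^ 2 / (ε * σ)) := by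
  obtain ⟨hβ0, -⟩ := hβ
  obtain ⟨hσ0, -⟩ := hσ
  refine ⟨fun x => ?_, fun x₀ hx₀ x => ?_⟩
  · have hw : Integrable (fun ω =>
        Real.exp (-‖x - β • η ω - σ • ξ₀ ω‖ ^ 2 / (2 * ε * β * σ))) P := by
      refine .of_bound (Measurable.aestronglyMeasurable (by fun_prop)) 1 (.of_forall fun ω => ?_)
      rw [Real.norm_of_nonneg (Real.exp_pos _).le, Real.exp_le_one_iff]
      exact div_nonpos_of_nonpos_of_nonneg (neg_nonpos.2 (sq_nonneg _)) (by positivity)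
    have hw0 := fun ω => (Real.exp_pos (-‖x - β • η ω - σ • ξ₀ ω‖ ^ 2 / (2 * ε * β * σ))).le
    rw [hD, norm_smul, norm_inv, Real.norm_of_nonneg (integral_nonneg hw0)]
    exact inv_mul_le_of_le_mul₀ (integral_nonneg hw0) hK.le
      ((norm_integral_smul_le_mul_integral hw hw0 hbdd).trans_eq (mul_comm _ _))
  · set g : Ω → ℝ := fun ω => Real.exp (-β * ‖η ω‖ ^ 2 / (2 * ε * σ))
    have hg : Integrable g P := by
      refine .of_bound (Measurable.aestronglyMeasurable (by fun_prop)) 1 (.of_forall fun ω => ?_)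
      rw [Real.norm_of_nonneg (Real.exp_pos _).le, Real.exp_le_one_iff, neg_mul]
      exact div_nonpos_of_nonpos_of_nonneg (neg_nonpos.2 (by positivity)) (by positivity)
    have hsplit : ∀ x ω, Real.exp (-‖x - β • η ω - σ • ξ₀ ω‖ ^ 2 / (2 * ε * β * σ)) =
        Real.exp (-‖x - σ • x₀‖ ^ 2 / (2 * ε * β * σ)) *
          (g ω * Real.exp ((ε * σ)⁻¹ * inner ℝ (η ω) (x - σ • x₀))) := by
      intro x ω
      rw [hx₀, sub_right_comm, norm_sub_sq_real, inner_smul_right, norm_smul,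
        Real.norm_of_nonneg hβ0.le, real_inner_comm, ← Real.exp_add, ← Real.exp_add]
      congr 1
      field_simp
      ring
    have hDeq : D = fun x => (fun y =>
        (∫ ω, g ω * Real.exp ((ε * σ)⁻¹ * inner ℝ (η ω) y) ∂P)⁻¹ •
          ∫ ω, (g ω * Real.exp ((ε * σ)⁻¹ * inner ℝ (η ω) y)) • η ω ∂P) (x - σ • x₀) := by
      funext x
      simp only [hD, hsplit]
      simp only [mul_smul (Real.exp (-‖x - σ • x₀‖ ^ 2 / (2 * ε * β * σ))), integral_smul,
        integral_const_mul]
      rw [smul_smul, mul_inv, mul_right_comm, inv_mul_cancel₀ (Real.exp_pos _).ne', one_mul]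
    obtain ⟨A, hA, hAK⟩ := exists_hasFDerivAt_tiltedMean_norm_le hg
      (fun ω => Real.exp_pos _) hη.aestronglyMeasurable hbdd
      (a := (ε * σ)⁻¹) (by positivity) (x - σ • x₀)
    have hDA : HasFDerivAt D A x := hDeq ▸ (hasFDerivAt_comp_sub _).2 hA
    rw [hDA.fderiv, div_eq_mul_inv]
    exact ⟨hDA.differentiableAt, hAK⟩
end

section
/- Let η be a random vector in ℝ^d with 𝔼|η| < ∞, let β, σ ∈ (0,1) with β + σ = 1, let σ' ∈ ℝ and β' := −σ', and let ℓ > 0. Define, for x ∈ ℝ^d, b(x) := σ' 𝔼[(x − η) e^{−|x − βη|²/(2ℓσ)}] / ( σ 𝔼[e^{−|x − βη|²/(2ℓσ)}] ) and φ(x) := 𝔼[e^{−|x − βη|²/(2ℓσ)}] / (2πℓσ)^{d/2}. Then φ is everywhere strictly positive and differentiable, and b(x) = (β'/β) ( ℓ ∇ log φ(x) + x ) for every x ∈ ℝ^d. -/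
open MeasureTheory ProbabilityTheory
open scoped ENNReal

section GaussianKernel

variable {E Ω : Type*} [NormedAddCommGroup E] [MeasurableSpace Ω] {P : Measure Ω} {X : Ω → E} {c : ℝ}

theorem exp_neg_sq_div_mul_le {t : ℝ} (hc : 0 < c) :
    Real.exp (-t ^ 2 / c) * t ≤ 1 + c := by
  have hexp : 1 + t ^ 2 / c ≤ Real.exp (t ^ 2 / c) := by
    linarith [Real.add_one_le_exp (t ^ 2 / c)]
  have hle : t ≤ (1 + c) * (1 + t ^ 2 / c) := by
    have hexpand : (1 + c) * (1 + t ^ 2 / c) = 1 + t ^ 2 / c + c + t ^ 2 := by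
      field_simp
      ring
    have : 0 ≤ t ^ 2 / c := by positivity
    nlinarith [sq_nonneg (t - 1)]
  rw [neg_div, Real.exp_neg, inv_mul_le_iff₀ (Real.exp_pos _), mul_comm]
  exact hle.trans (mul_le_mul_of_nonneg_left hexp (by positivity))

theorem integrable_exp_neg_norm_sub_sq_div [IsFiniteMeasure P] (hX : AEStronglyMeasurable X P)
    (hc : 0 < c) (x : E) : Integrable (fun ω => Real.exp (-‖x - X ω‖ ^ 2 / c)) P := by
  refine Integrable.of_bound ?_ 1 (.of_forall fun ω => ?_)
  · exact (by fun_prop : Continuous fun y : E => Real.exp (-‖x - y‖ ^ 2 / c))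
      |>.comp_aestronglyMeasurable hX
  · rw [Real.norm_of_nonneg (Real.exp_pos _).le, Real.exp_le_one_iff, neg_div]
    exact neg_nonpos.2 (by positivity)

theorem norm_exp_neg_norm_sq_div_smul_le [NormedSpace ℝ E] (hc : 0 < c) (y : E) :
    ‖Real.exp (-‖y‖ ^ 2 / c) • y‖ ≤ 1 + c := by
  rw [norm_smul, Real.norm_of_nonneg (Real.exp_pos _).le]
  exact exp_neg_sq_div_mul_le hc

theorem integrable_exp_neg_norm_sub_sq_div_smul [NormedSpace ℝ E] [IsFiniteMeasure P]
    (hX : AEStronglyMeasurable X P) (hc : 0 < c) (x : E) :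
    Integrable (fun ω => Real.exp (-‖x - X ω‖ ^ 2 / c) • (x - X ω)) P := by
  refine Integrable.of_bound ?_ (1 + c) (.of_forall fun ω => norm_exp_neg_norm_sq_div_smul_le hc _)
  exact (by fun_prop : Continuous fun y : E => Real.exp (-‖x - y‖ ^ 2 / c) • (x - y))
    |>.comp_aestronglyMeasurable hX

theorem hasGradientAt_integral_exp_neg_norm_sub_sq_div [InnerProductSpace ℝ E] [CompleteSpace E]
    [IsFiniteMeasure P] (hX : AEStronglyMeasurable X P) (hc : 0 < c) (x : E) :
    HasGradientAt (fun y => ∫ ω, Real.exp (-‖y - X ω‖ ^ 2 / c) ∂P)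
      (-(2 / c) • ∫ ω, Real.exp (-‖x - X ω‖ ^ 2 / c) • (x - X ω) ∂P) x := by
  have hsmul (y : E) := (integrable_exp_neg_norm_sub_sq_div_smul hX hc y).smul (-(2 / c))
  rw [hasGradientAt_iff_hasFDerivAt, ← integral_smul]
  have hdual := (InnerProductSpace.toDual ℝ E).toContinuousLinearEquiv.toContinuousLinearMap
    |>.integral_comp_comm (hsmul x)
  have key := hasFDerivAt_integral_of_dominated_of_fderiv_le (𝕜 := ℝ) (μ := P)
    (F := fun y ω => Real.exp (-‖y - X ω‖ ^ 2 / c))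
    (F' := fun y ω => InnerProductSpace.toDual ℝ E
      (-(2 / c) • Real.exp (-‖y - X ω‖ ^ 2 / c) • (y - X ω)))
    (bound := fun _ => 2 / c * (1 + c)) (x₀ := x) (s := Set.univ) Filter.univ_mem
    (.of_forall fun y => (integrable_exp_neg_norm_sub_sq_div hX hc y).aestronglyMeasurable)
    (integrable_exp_neg_norm_sub_sq_div hX hc x)
    ((InnerProductSpace.toDual ℝ E).continuous.comp_aestronglyMeasurable
      (hsmul x).aestronglyMeasurable)
    (.of_forall fun ω y _ => ?_) (integrable_const _) (.of_forall fun ω y _ => ?_)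
  · exact key.congr_fderiv hdual
  · rw [LinearIsometryEquiv.norm_map, norm_smul, norm_neg, Real.norm_of_nonneg (by positivity)]
    gcongr
    exact norm_exp_neg_norm_sq_div_smul_le hc _
  · have h := ((((hasFDerivAt_id (𝕜 := ℝ) y).sub_const (X ω)).norm_sq).fun_neg.mul_const c⁻¹).exp
    simp only [← div_eq_mul_inv] at h
    refine h.congr_fderiv ?_
    ext v
    simp
    ring

end GaussianKernel

/-- Score-function representation of the zero-order drift: with
`φ(x) = 𝔼[e^{−|x−βη|²/(2ℓσ)}]/(2πℓσ)^{d/2}` and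
`b(x) = σ'𝔼[(x−η)e^{−|x−βη|²/(2ℓσ)}]/(σ𝔼[e^{−|x−βη|²/(2ℓσ)}])`, the density `φ` is strictly
positive and differentiable, and `b(x) = (β'/β)(ℓ ∇log φ(x) + x)` where `β' = −σ'`. -/
theorem drift_score_representation
    {d : ℕ} {Ω : Type*} [MeasurableSpace Ω] (P : Measure Ω) [IsProbabilityMeasure P]
    (η : Ω → EuclideanSpace ℝ (Fin d)) (hη : Measurable η)
    (hint : Integrable (fun ω => ‖η ω‖) P)
    (β σ : ℝ) (hβ : β ∈ Set.Ioo (0 : ℝ) 1) (hσ : σ ∈ Set.Ioo (0 : ℝ) 1) (hβσ : β + σ = 1)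
    (σ' β' : ℝ) (hβ' : β' = -σ') (ℓ : ℝ) (hℓ : 0 < ℓ)
    (φ : EuclideanSpace ℝ (Fin d) → ℝ)
    (hφ : ∀ x, φ x =
      (∫ ω, Real.exp (-‖x - β • η ω‖ ^ 2 / (2 * ℓ * σ)) ∂P)
        / (2 * Real.pi * ℓ * σ) ^ ((d : ℝ) / 2))
    (b : EuclideanSpace ℝ (Fin d) → EuclideanSpace ℝ (Fin d))
    (hb : ∀ x, b x =
      (σ' / (σ * ∫ ω, Real.exp (-‖x - β • η ω‖ ^ 2 / (2 * ℓ * σ)) ∂P))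
        • ∫ ω, Real.exp (-‖x - β • η ω‖ ^ 2 / (2 * ℓ * σ)) • (x - η ω) ∂P) :
    (∀ x, 0 < φ x ∧ DifferentiableAt ℝ φ x) ∧
      ∀ x, b x = (β' / β) • (ℓ • gradient (fun y => Real.log (φ y)) x + x) := by
  have hβ0 := hβ.1
  have hσ0 := hσ.1
  have hc : 0 < 2 * ℓ * σ := by positivity
  have hX : AEStronglyMeasurable (fun ω => β • η ω) P := by fun_prop
  set Z : EuclideanSpace ℝ (Fin d) → ℝ :=
    fun x => ∫ ω, Real.exp (-‖x - β • η ω‖ ^ 2 / (2 * ℓ * σ)) ∂P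
  set N : ℝ := (2 * Real.pi * ℓ * σ) ^ ((d : ℝ) / 2)
  have hN : 0 < N := by positivity
  have hZpos x : 0 < Z x := integral_exp_pos (integrable_exp_neg_norm_sub_sq_div hX hc x)
  have hgrad x := (hasGradientAt_integral_exp_neg_norm_sub_sq_div hX hc x).hasFDerivAt
  have hφZ : φ = fun x => Z x / N := funext hφ
  refine ⟨fun x => ⟨?_, ?_⟩, fun x => ?_⟩
  · rw [hφZ]
    exact div_pos (hZpos x) hN
  · rw [hφZ]
    simp_rw [div_eq_mul_inv]
    exact (hgrad x).differentiableAt.mul_const N⁻¹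
  set V := ∫ ω, Real.exp (-‖x - β • η ω‖ ^ 2 / (2 * ℓ * σ)) • (x - β • η ω) ∂P
  have hlog : gradient (fun y => Real.log (φ y)) x = (Z x)⁻¹ • -(2 / (2 * ℓ * σ)) • V := by
    have hsplit : (fun y => Real.log (φ y)) = fun y => Real.log (Z y) - Real.log N := by
      ext y
      rw [hφ, Real.log_div (hZpos y).ne' hN.ne']
    rw [hsplit]
    apply HasGradientAt.gradient
    rw [hasGradientAt_iff_hasFDerivAt, map_smul]
    exact ((hgrad x).log (hZpos x).ne').sub_const _
  have hdrift : ∫ ω, Real.exp (-‖x - β • η ω‖ ^ 2 / (2 * ℓ * σ)) • (x - η ω) ∂P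
      = β⁻¹ • (V - (σ * Z x) • x) := by
    have hpoint ω : Real.exp (-‖x - β • η ω‖ ^ 2 / (2 * ℓ * σ)) • (x - η ω) =
        β⁻¹ • (Real.exp (-‖x - β • η ω‖ ^ 2 / (2 * ℓ * σ)) • (x - β • η ω)
          - Real.exp (-‖x - β • η ω‖ ^ 2 / (2 * ℓ * σ)) • σ • x) := by
      rw [← smul_sub, smul_comm β⁻¹]
      congr 1
      rw [eq_inv_smul_iff₀ hβ0.ne', eq_sub_of_add_eq' hβσ]
      module
    simp_rw [hpoint]
    rw [integral_smul, integral_sub (integrable_exp_neg_norm_sub_sq_div_smul hX hc x)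
      ((integrable_exp_neg_norm_sub_sq_div hX hc x).smul_const _), integral_smul_const,
      smul_smul, mul_comm σ (Z x)]
  rw [hb, hlog, hdrift, hβ']
  have hZx := (hZpos x).ne'
  change (σ' / (σ * Z x)) • _ = _
  match_scalars <;> field_simp
end

section
/- Let ρ₁ : ℝ^d → [0, ∞) be a C¹ probability density (ρ₁ ≥ 0, ∫ ρ₁ = 1) such that for some κ > 0 and m ≥ 0, ρ₁(y) + |∇ρ₁(y)| ≤ κ(1 + |y|)^m for all y. Let λ > 0, β, σ ∈ (0,1) with β + σ = 1, ℓ > 0, σ' ∈ ℝ and β' := −σ'. Let ξ be a random vector in ℝ^d with law N(0, I_d/λ), i.e. with density y ↦ (λ/(2π))^{d/2} e^{−λ|y|²/2}, and for fixed x ∈ ℝ^d set w(z) := e^{β|x − √(ℓσ) z|²/(2ℓ) + (λ − β)|z|²/2}. Then all the expectations below are finite, the denominator is strictly positive, and √ℓ σ' 𝔼[ξ w(ξ) ρ₁(x − √(ℓσ) ξ)] / ( √σ 𝔼[w(ξ) ρ₁(x − √(ℓσ) ξ)] ) = (β'/β) ( x + ℓ 𝔼[w(ξ) ∇ρ₁(x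 − √(ℓσ) ξ)] / ( β 𝔼[w(ξ) ρ₁(x − √(ℓσ) ξ)] ) ). -/
open MeasureTheory ProbabilityTheory
open scoped ENNReal

/-- A function of at most exponential growth is integrable against a Gaussian weight. -/
theorem integrable_exp_quadratic_smul {E F : Type*}
    [NormedAddCommGroup E] [InnerProductSpace ℝ E] [FiniteDimensional ℝ E]
    [MeasurableSpace E] [BorelSpace E] [NormedAddCommGroup F] [NormedSpace ℝ F]
    {b : ℝ} (hb : 0 < b) (a : ℝ) (v : E) {f : E → F} (hf : Continuous f) {C B : ℝ}
    (hbound : ∀ z, ‖f z‖ ≤ C * Real.exp (B * ‖z‖)) :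
    Integrable (fun z => Real.exp (a + inner ℝ v z - b / 2 * ‖z‖ ^ 2) • f z) := by
  have hgauss : Integrable (fun z : E => Real.exp (-(b / 4) * ‖z‖ ^ 2)) := by
    have h := (GaussianFourier.integrable_cexp_neg_mul_sq_norm_add (V := E)
      (b := ((b / 4 : ℝ) : ℂ)) (by simpa using hb) 0 0).norm
    refine h.congr (ae_of_all _ fun z => ?_)
    simp only [Complex.norm_exp]
    congr 1
    norm_cast
    simp
  refine (hgauss.const_mul (C * Real.exp (a + (‖v‖ + B) ^ 2 / b))).mono'
    (by fun_prop) (ae_of_all _ fun z => ?_)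
  have hC : 0 ≤ C := by simpa using (norm_nonneg _).trans (hbound 0)
  rw [norm_smul, Real.norm_of_nonneg (Real.exp_nonneg _)]
  calc
    _ ≤ Real.exp (a + ‖v‖ * ‖z‖ - b / 2 * ‖z‖ ^ 2) * (C * Real.exp (B * ‖z‖)) := by
      gcongr
      · exact real_inner_le_norm v z
      · exact hbound z
    _ = C * Real.exp (a + (‖v‖ + B) * ‖z‖ - b / 2 * ‖z‖ ^ 2) := by
      rw [mul_left_comm, ← Real.exp_add]
      ring_nf
    _ ≤ C * Real.exp (a + (‖v‖ + B) ^ 2 / b + -(b / 4) * ‖z‖ ^ 2) := by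
      gcongr
      have h : 0 ≤ (‖v‖ + B - b / 2 * ‖z‖) ^ 2 / b := by positivity
      have h' : (‖v‖ + B - b / 2 * ‖z‖) ^ 2 / b
          = (‖v‖ + B) ^ 2 / b - (‖v‖ + B) * ‖z‖ + b / 4 * ‖z‖ ^ 2 := by
        field_simp
        ring
      linarith
    _ = _ := by rw [Real.exp_add, mul_assoc]

theorem ContDiff.continuous_gradient {E : Type*} [NormedAddCommGroup E] [InnerProductSpace ℝ E]
    [CompleteSpace E] {g : E → ℝ} (hg : ContDiff ℝ 1 g) : Continuous (gradient g) :=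
  (InnerProductSpace.toDual ℝ E).symm.continuous.comp (hg.continuous_fderiv one_ne_zero)

/-- Gaussian integration by parts (Stein's identity). -/
theorem integral_exp_quadratic_mul_smul_self {E : Type*}
    [NormedAddCommGroup E] [InnerProductSpace ℝ E] [FiniteDimensional ℝ E]
    [MeasurableSpace E] [BorelSpace E]
    {b : ℝ} (hb : 0 < b) (a : ℝ) (v : E) {g : E → ℝ} (hg : ContDiff ℝ 1 g) {C B : ℝ}
    (hbound : ∀ z, ‖g z‖ ≤ C * Real.exp (B * ‖z‖))
    (hbound' : ∀ z, ‖gradient g z‖ ≤ C * Real.exp (B * ‖z‖)) :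
    Integrable (fun z => (Real.exp (a + inner ℝ v z - b / 2 * ‖z‖ ^ 2) * g z) • z) ∧
    b • ∫ z, (Real.exp (a + inner ℝ v z - b / 2 * ‖z‖ ^ 2) * g z) • z
      = (∫ z, Real.exp (a + inner ℝ v z - b / 2 * ‖z‖ ^ 2) * g z) • v
        + ∫ z, Real.exp (a + inner ℝ v z - b / 2 * ‖z‖ ^ 2) • gradient g z := by
  set G : E → ℝ := fun z => Real.exp (a + inner ℝ v z - b / 2 * ‖z‖ ^ 2) with hG
  have hC : 0 ≤ C := by simpa using (norm_nonneg _).trans (hbound 0)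
  have hgc := hg.continuous
  have hint : Integrable (fun z => G z * g z) :=
    integrable_exp_quadratic_smul hb a v hgc hbound
  have hint_grad : Integrable (fun z => G z • gradient g z) :=
    integrable_exp_quadratic_smul hb a v hg.continuous_gradient hbound'
  have hint_id : Integrable (fun z => (G z * g z) • z) := by
    have h := integrable_exp_quadratic_smul hb a v (f := fun z => g z • z) (C := C) (B := B + 1)
      (by fun_prop) fun z => by
        rw [norm_smul, add_mul, Real.exp_add, ← mul_assoc, one_mul]
        gcongr
        · exact hbound z
        · linarith [Real.add_one_le_exp ‖z‖]
    simpa only [smul_smul] using h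
  refine ⟨hint_id, ?_⟩
  have hG' (z : E) : HasFDerivAt G (G z • (innerSL ℝ v - b • innerSL ℝ z)) z := by
    have h := ((((innerSL ℝ v).hasFDerivAt (x := z)).const_add a).sub
      ((hasStrictFDerivAt_norm_sq z).hasFDerivAt.const_mul (b / 2))).exp
    refine h.congr_fderiv ?_
    ext y
    simp [hG]
    ring
  refine ext_inner_left ℝ fun e => ?_
  have hfG (z : E) : fderiv ℝ G z e * g z
      = (G z * g z) * inner ℝ e v - b * inner ℝ e ((G z * g z) • z) := by
    rw [(hG' z).fderiv, inner_smul_right, real_inner_comm v, real_inner_comm z]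
    simp
    ring
  have hfg (z : E) : G z * fderiv ℝ g z e = inner ℝ e (G z • gradient g z) := by
    rw [((hg.differentiable one_ne_zero) z).hasGradientAt.fderiv_apply, inner_smul_right,
      real_inner_comm]
  have h1 : Integrable (fun z => (G z * g z) * inner ℝ e v) := hint.mul_const _
  have h2 : Integrable (fun z => b * inner ℝ e ((G z * g z) • z)) :=
    (hint_id.const_inner e).const_mul b
  have key := integral_mul_fderiv_eq_neg_fderiv_mul_of_integrable (μ := volume)
    (f := G) (g := g) (v := e) (by simp_rw [hfG]; exact h1.sub h2)
    (by simpa only [hfg] using hint_grad.const_inner e) hint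
    (fun z _ => (hG' z).differentiableAt) fun z _ => hg.differentiable one_ne_zero z
  simp_rw [hfG, hfg] at key
  rw [integral_sub h1 h2, integral_mul_const, integral_const_mul, integral_inner hint_id,
    integral_inner hint_grad] at key
  rw [inner_add_right, inner_smul_right, inner_smul_right]
  linarith

/-- Change of variables for a random vector with a real-valued density. -/
theorem integrable_comp_iff_and_integral_comp_of_map_eq_withDensity {Ω E F : Type*}
    [MeasurableSpace Ω] {P : Measure Ω} [MeasurableSpace E] {μ : Measure E}
    [NormedAddCommGroup F] [NormedSpace ℝ F] {ξ : Ω → E} (hξ : Measurable ξ) {p : E → ℝ}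
    (hp : Measurable p) (hp0 : ∀ z, 0 ≤ p z)
    (hlaw : P.map ξ = μ.withDensity fun z => ENNReal.ofReal (p z))
    {f : E → F} (hf : StronglyMeasurable f) :
    (Integrable (fun ω => f (ξ ω)) P ↔ Integrable (fun z => p z • f z) μ) ∧
      ∫ ω, f (ξ ω) ∂P = ∫ z, p z • f z ∂μ := by
  constructor
  · rw [← Function.comp_def, ← integrable_map_measure hf.aestronglyMeasurable hξ.aemeasurable,
      hlaw, integrable_withDensity_iff_integrable_smul' (by fun_prop) (by simp)]
    simp only [ENNReal.toReal_ofReal (hp0 _)]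
  · rw [← integral_map hξ.aemeasurable hf.aestronglyMeasurable, hlaw,
      integral_withDensity_eq_integral_toReal_smul (by fun_prop) (by simp)]
    simp only [ENNReal.toReal_ofReal (hp0 _)]

theorem gradient_comp_const_sub_smul {E : Type*} [NormedAddCommGroup E] [InnerProductSpace ℝ E]
    [CompleteSpace E] {f : E → ℝ} (hf : Differentiable ℝ f) (x : E) (s : ℝ) (z : E) :
    gradient (fun y => f (x - s • y)) z = -s • gradient f (x - s • z) := by
  refine HasGradientAt.gradient ?_
  have h : HasFDerivAt (fun y : E => x - s • y) (-(s • ContinuousLinearMap.id ℝ E)) z :=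
    ((hasFDerivAt_id z).const_smul s).const_sub x
  have h' := (hf (x - s • z)).hasGradientAt.hasFDerivAt.comp z h
  rw [hasGradientAt_iff_hasFDerivAt]
  refine h'.congr_fderiv ?_
  ext y
  simp


/-- Second-order scheme identity: for a `C¹` probability density `ρ₁` of polynomial growth
together with its gradient, `ξ ~ N(0, I_d/λ)`, `β + σ = 1` and
`w(z) = e^{β|x−√(ℓσ)z|²/(2ℓ) + (λ−β)|z|²/2}`, all the expectations below are finite,
the denominator is positive, and
`√ℓ σ' 𝔼[ξ w(ξ) ρ₁(x−√(ℓσ)ξ)]/(√σ 𝔼[w(ξ)ρ₁(x−√(ℓσ)ξ)])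
  = (β'/β)(x + ℓ 𝔼[w(ξ)∇ρ₁(x−√(ℓσ)ξ)]/(β 𝔼[w(ξ)ρ₁(x−√(ℓσ)ξ)]))`. -/
theorem second_order_scheme_identity
    {d : ℕ} {Ω : Type*} [MeasurableSpace Ω] (P : Measure Ω) [IsProbabilityMeasure P]
    (ρ₁ : EuclideanSpace ℝ (Fin d) → ℝ) (hρC1 : ContDiff ℝ 1 ρ₁)
    (hρ0 : ∀ y, 0 ≤ ρ₁ y) (hρ1 : ∫ y, ρ₁ y ∂volume = 1)
    (κ m : ℝ) (hκ : 0 < κ) (hm : 0 ≤ m)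
    (hgrowth : ∀ y, ρ₁ y + ‖gradient ρ₁ y‖ ≤ κ * (1 + ‖y‖) ^ m)
    (lam : ℝ) (hlam : 0 < lam)
    (β σ : ℝ) (hβ : β ∈ Set.Ioo (0 : ℝ) 1) (hσ : σ ∈ Set.Ioo (0 : ℝ) 1) (hβσ : β + σ = 1)
    (ℓ : ℝ) (hℓ : 0 < ℓ) (σ' β' : ℝ) (hβ' : β' = -σ')
    (ξ : Ω → EuclideanSpace ℝ (Fin d)) (hξ : Measurable ξ)
    (hlaw : Measure.map ξ P = volume.withDensity (fun y =>
      ENNReal.ofReal ((lam / (2 * Real.pi)) ^ ((d : ℝ) / 2)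
        * Real.exp (-lam * ‖y‖ ^ 2 / 2))))
    (x : EuclideanSpace ℝ (Fin d))
    (w : EuclideanSpace ℝ (Fin d) → ℝ)
    (hw : ∀ z, w z = Real.exp (β * ‖x - Real.sqrt (ℓ * σ) • z‖ ^ 2 / (2 * ℓ)
        + (lam - β) * ‖z‖ ^ 2 / 2)) :
    Integrable (fun ω => w (ξ ω) * ρ₁ (x - Real.sqrt (ℓ * σ) • ξ ω)) P ∧
    Integrable (fun ω => (w (ξ ω) * ρ₁ (x - Real.sqrt (ℓ * σ) • ξ ω)) • ξ ω) P ∧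
    Integrable (fun ω => w (ξ ω) • gradient ρ₁ (x - Real.sqrt (ℓ * σ) • ξ ω)) P ∧
    0 < ∫ ω, w (ξ ω) * ρ₁ (x - Real.sqrt (ℓ * σ) • ξ ω) ∂P ∧
    (Real.sqrt ℓ * σ'
        / (Real.sqrt σ * ∫ ω, w (ξ ω) * ρ₁ (x - Real.sqrt (ℓ * σ) • ξ ω) ∂P))
      • (∫ ω, (w (ξ ω) * ρ₁ (x - Real.sqrt (ℓ * σ) • ξ ω)) • ξ ω ∂P)
      = (β' / β) • (x +
          (ℓ / (β * ∫ ω, w (ξ ω) * ρ₁ (x - Real.sqrt (ℓ * σ) • ξ ω) ∂P))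
            • ∫ ω, w (ξ ω) • gradient ρ₁ (x - Real.sqrt (ℓ * σ) • ξ ω) ∂P) := by
  obtain ⟨hβ0, -⟩ := hβ
  obtain ⟨hσ0, -⟩ := hσ
  set s : ℝ := Real.sqrt (ℓ * σ) with hs
  have hs0 : 0 < s := Real.sqrt_pos.2 (mul_pos hℓ hσ0)
  have hs2 : s ^ 2 = ℓ * σ := Real.sq_sqrt (by positivity)
  set c : ℝ := (lam / (2 * Real.pi)) ^ ((d : ℝ) / 2) with hc
  have hc0 : 0 < c := by positivity
  set p : EuclideanSpace ℝ (Fin d) → ℝ := fun y => c * Real.exp (-lam * ‖y‖ ^ 2 / 2) with hp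
  set a : ℝ := Real.log c + β * ‖x‖ ^ 2 / (2 * ℓ) with ha
  set v : EuclideanSpace ℝ (Fin d) := -(β * s / ℓ) • x with hv
  have hβ2 : 0 < β ^ 2 := by positivity
  set G : EuclideanSpace ℝ (Fin d) → ℝ :=
    fun z => Real.exp (a + inner ℝ v z - β ^ 2 / 2 * ‖z‖ ^ 2) with hG
  have hpw (z) : p z * w z = G z := by
    simp only [hp, hw, hG, ha]
    nth_rewrite 1 [← Real.exp_log hc0]
    rw [← Real.exp_add, ← Real.exp_add, norm_sub_sq_real, inner_smul_right, norm_smul, mul_pow,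
      Real.norm_eq_abs, sq_abs, hs2, hv, inner_smul_left, show σ = 1 - β by linarith]
    congr 1
    simp
    field_simp
    ring
  have hwc : Continuous w := by
    rw [funext hw]
    fun_prop
  have hρc := hρC1.continuous
  have hgradc := hρC1.continuous_gradient
  set C : ℝ := κ * Real.exp (m * ‖x‖) with hC
  have hexp (z) : κ * (1 + ‖x - s • z‖) ^ m ≤ C * Real.exp (m * s * ‖z‖) := by
    rw [hC, mul_assoc, ← Real.exp_add]
    gcongr
    calc
      (1 + ‖x - s • z‖) ^ m ≤ Real.exp (‖x‖ + s * ‖z‖) ^ m := by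
        gcongr
        have h := norm_sub_le x (s • z)
        rw [norm_smul, Real.norm_of_nonneg hs0.le] at h
        linarith [Real.add_one_le_exp (‖x‖ + s * ‖z‖)]
      _ = _ := by
        rw [← Real.exp_mul]
        ring_nf
  have hρbound (z) : ‖ρ₁ (x - s • z)‖ ≤ C * Real.exp (m * s * ‖z‖) := by
    rw [Real.norm_of_nonneg (hρ0 _)]
    linarith [hexp z, hgrowth (x - s • z), norm_nonneg (gradient ρ₁ (x - s • z))]
  have hgbound (z) : ‖gradient ρ₁ (x - s • z)‖ ≤ C * Real.exp (m * s * ‖z‖) := by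
    linarith [hexp z, hgrowth (x - s • z), hρ0 (x - s • z)]
  have hC0 : 0 < C := by positivity
  have hD := integrable_exp_quadratic_smul hβ2 a v (f := fun z => ρ₁ (x - s • z))
    (by fun_prop) hρbound
  have hB := integrable_exp_quadratic_smul hβ2 a v (f := fun z => gradient ρ₁ (x - s • z))
    (by fun_prop) hgbound
  obtain ⟨hA, stein⟩ := integral_exp_quadratic_mul_smul_self hβ2 a v
    (g := fun z => ρ₁ (x - s • z)) (C := C * (1 + s)) (B := m * s) (by fun_prop)
    (fun z => (hρbound z).trans <| by gcongr; nlinarith)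
    (fun z => by
      rw [gradient_comp_const_sub_smul (hρC1.differentiable one_ne_zero), norm_smul, norm_neg,
        Real.norm_of_nonneg hs0.le, mul_comm C, mul_assoc]
      gcongr
      · linarith
      · exact hgbound z)
  simp only [gradient_comp_const_sub_smul (hρC1.differentiable one_ne_zero)] at stein
  change Integrable (fun z => G z * ρ₁ (x - s • z)) at hD
  change Integrable (fun z => G z • gradient ρ₁ (x - s • z)) at hB
  change Integrable (fun z => (G z * ρ₁ (x - s • z)) • z) at hA
  change β ^ 2 • ∫ z, (G z * ρ₁ (x - s • z)) • z = (∫ z, G z * ρ₁ (x - s • z)) • v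
    + ∫ z, G z • (-s) • gradient ρ₁ (x - s • z) at stein
  simp_rw [smul_comm _ (-s), integral_smul] at stein
  have hpm : Measurable p := by fun_prop
  have hp0 (z) : 0 ≤ p z := by positivity
  obtain ⟨hDi, hDe⟩ := integrable_comp_iff_and_integral_comp_of_map_eq_withDensity hξ hpm hp0 hlaw
    (f := fun z => w z * ρ₁ (x - s • z)) (Continuous.stronglyMeasurable (by fun_prop))
  obtain ⟨hAi, hAe⟩ := integrable_comp_iff_and_integral_comp_of_map_eq_withDensity hξ hpm hp0 hlaw
    (f := fun z => (w z * ρ₁ (x - s • z)) • z) (Continuous.stronglyMeasurable (by fun_prop))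
  obtain ⟨hBi, hBe⟩ := integrable_comp_iff_and_integral_comp_of_map_eq_withDensity hξ hpm hp0 hlaw
    (f := fun z => w z • gradient ρ₁ (x - s • z)) (Continuous.stronglyMeasurable (by fun_prop))
  simp only [smul_smul, smul_eq_mul, ← mul_assoc, hpw] at hDi hDe hAi hAe hBi hBe
  have hpos : 0 < ∫ z, G z * ρ₁ (x - s • z) := by
    have hcont : Continuous fun z => G z * ρ₁ (x - s • z) := by fun_prop
    rw [integral_pos_iff_support_of_nonneg
      (fun z => mul_nonneg (Real.exp_nonneg _) (hρ0 _)) hD]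
    refine hcont.isOpen_support.measure_pos _ ?_
    obtain ⟨y, hy⟩ : ∃ y, ρ₁ y ≠ 0 := by
      by_contra! h
      simp [h] at hρ1
    refine ⟨s⁻¹ • (x - y), mul_ne_zero (Real.exp_ne_zero _) ?_⟩
    rwa [smul_inv_smul₀ hs0.ne', sub_sub_cancel]
  rw [hDe, hAe, hBe]
  refine ⟨hDi.2 hD, hAi.2 hA, hBi.2 hB, hpos, ?_⟩
  set D := ∫ z, G z * ρ₁ (x - s • z)
  set A := ∫ z, (G z * ρ₁ (x - s • z)) • z
  set B := ∫ z, G z • gradient ρ₁ (x - s • z)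
  have hA_eq : A = (β ^ 2)⁻¹ • (D • v + -s • B) := by
    rw [← stein, inv_smul_smul₀ hβ2.ne']
  have hsℓ : s = Real.sqrt ℓ * Real.sqrt σ := Real.sqrt_mul hℓ.le σ
  have hσs : 0 < Real.sqrt σ := Real.sqrt_pos.2 hσ0
  have hℓs : Real.sqrt ℓ ^ 2 = ℓ := Real.sq_sqrt hℓ.le
  have hℓs0 : 0 < Real.sqrt ℓ := Real.sqrt_pos.2 hℓ
  rw [hA_eq, hv, hβ', hsℓ]
  match_scalars <;> field_simp <;> rw [hℓs] <;> field_simp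
end

section
/- Let λ, ℓ > 0, β, σ ∈ (0,1) with β + σ = 1. Let η be a random vector in ℝ^d with density ρ₁ (a probability density), with 𝔼η = 0 and 𝔼|η|² < ∞. For x, y ∈ ℝ^d set 𝒞(x, y) := e^{β|x − √(ℓσ) y|²/(2ℓ) + (λ − β)|y|²/2} ρ₁(x − √(ℓσ) y). Then for every x ∈ ℝ^d, ∫_{ℝ^d} 𝒞(x, y) (λ/(2π))^{d/2} e^{−λ|y|²/2} dy ≥ (2πℓσ/λ)^{−d/2} e^{−β(|x|² + β 𝔼|η|²)/(2ℓσ)}. -/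
open MeasureTheory ProbabilityTheory
open scoped ENNReal

open Module in
/-- Affine change of variables `z = x - c • y` for the Lebesgue integral. -/
lemma lintegral_comp_sub_smul {E : Type*} [NormedAddCommGroup E] [NormedSpace ℝ E]
    [MeasurableSpace E] [BorelSpace E] [FiniteDimensional ℝ E] (μ : Measure E)
    [μ.IsAddHaarMeasure] {f : E → ℝ≥0∞} (hf : Measurable f) (x : E) {c : ℝ} (hc : 0 < c) :
    ∫⁻ y, f (x - c • y) ∂μ = ENNReal.ofReal (c ^ finrank ℝ E)⁻¹ * ∫⁻ z, f z ∂μ := by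
  have hg : Measurable fun z => f (x - z) := hf.comp (measurable_const.sub measurable_id)
  rw [← lintegral_map hg (measurable_const_smul c), Measure.map_addHaar_smul μ hc.ne',
    lintegral_smul_measure, lintegral_sub_left_eq_self, abs_of_nonneg (by positivity), smul_eq_mul]

/-- Jensen's inequality for the exponential, without assuming `exp ∘ g` integrable. -/
lemma ofReal_exp_integral_le_lintegral {Ω : Type*} [MeasurableSpace Ω] {P : Measure Ω}
    [IsProbabilityMeasure P] {g : Ω → ℝ} (hg : Integrable g P) :
    ENNReal.ofReal (Real.exp (∫ ω, g ω ∂P)) ≤ ∫⁻ ω, ENNReal.ofReal (Real.exp (g ω)) ∂P := by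
  have hpos : 0 ≤ᵐ[P] fun ω => Real.exp (g ω) := ae_of_all _ fun _ => (Real.exp_pos _).le
  by_cases hint : Integrable (fun ω => Real.exp (g ω)) P
  · rw [← ofReal_integral_eq_lintegral_ofReal hint hpos]
    exact ENNReal.ofReal_le_ofReal <| convexOn_exp.map_integral_le
      Real.continuous_exp.continuousOn isClosed_univ (ae_of_all _ fun _ => Set.mem_univ _) hg hint
  · have hmeas : AEStronglyMeasurable (fun ω => Real.exp (g ω)) P :=
      Real.continuous_exp.comp_aestronglyMeasurable hg.aestronglyMeasurable
    rw [← lintegral_ofReal_ne_top_iff_integrable hmeas hpos, not_not] at hint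
    simp [hint]

/-- A second-moment expansion around an arbitrary point for a centred random vector. -/
lemma integral_norm_sub_sq_of_integral_eq_zero {E Ω : Type*} [NormedAddCommGroup E]
    [InnerProductSpace ℝ E] [CompleteSpace E] [MeasurableSpace Ω] {P : Measure Ω}
    [IsProbabilityMeasure P] {η : Ω → E} (hη : Integrable η P) (hmean : ∫ ω, η ω ∂P = 0)
    (hmom : Integrable (fun ω => ‖η ω‖ ^ 2) P) (x : E) :
    Integrable (fun ω => ‖x - η ω‖ ^ 2) P ∧
      ∫ ω, ‖x - η ω‖ ^ 2 ∂P = ‖x‖ ^ 2 + ∫ ω, ‖η ω‖ ^ 2 ∂P := by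
  have hinner : Integrable (fun ω => 2 * inner ℝ x (η ω)) P := (hη.const_inner x).const_mul 2
  have hdiff : Integrable (fun ω => ‖x‖ ^ 2 - 2 * inner ℝ x (η ω)) P :=
    (integrable_const _).sub hinner
  simp_rw [norm_sub_sq_real]
  refine ⟨hdiff.add hmom, ?_⟩
  rw [integral_add hdiff hmom, integral_sub (integrable_const _) hinner, integral_const_mul,
    integral_inner hη, hmean]
  simp

/-- Jensen lower bound for the first-order denominator: if `η` has density `ρ₁`, mean `0`
and finite second moment, `β + σ = 1`, and
`𝒞(x,y) = e^{β|x−√(ℓσ)y|²/(2ℓ) + (λ−β)|y|²/2} ρ₁(x−√(ℓσ)y)`, then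
`∫ 𝒞(x,y) (λ/2π)^{d/2} e^{−λ|y|²/2} dy ≥ (2πℓσ/λ)^{−d/2} e^{−β(|x|² + β𝔼|η|²)/(2ℓσ)}`. -/
theorem weight_jensen_lower_bound
    {d : ℕ} {Ω : Type*} [MeasurableSpace Ω] (P : Measure Ω) [IsProbabilityMeasure P]
    (lam ℓ : ℝ) (hlam : 0 < lam) (hℓ : 0 < ℓ)
    (β σ : ℝ) (hβ : β ∈ Set.Ioo (0 : ℝ) 1) (hσ : σ ∈ Set.Ioo (0 : ℝ) 1) (hβσ : β + σ = 1)
    (η : Ω → EuclideanSpace ℝ (Fin d)) (hη : Measurable η)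
    (ρ₁ : EuclideanSpace ℝ (Fin d) → ℝ) (hρmeas : Measurable ρ₁) (hρ0 : ∀ y, 0 ≤ ρ₁ y)
    (hlaw : Measure.map η P = volume.withDensity (fun y => ENNReal.ofReal (ρ₁ y)))
    (hmean : ∫ ω, η ω ∂P = 0)
    (hmom : Integrable (fun ω => ‖η ω‖ ^ 2) P)
    (x : EuclideanSpace ℝ (Fin d)) :
    ENNReal.ofReal ((2 * Real.pi * ℓ * σ / lam) ^ (-(d : ℝ) / 2)
        * Real.exp (-β * (‖x‖ ^ 2 + β * ∫ ω, ‖η ω‖ ^ 2 ∂P) / (2 * ℓ * σ)))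
      ≤ ∫⁻ y, ENNReal.ofReal
          ((Real.exp (β * ‖x - Real.sqrt (ℓ * σ) • y‖ ^ 2 / (2 * ℓ)
              + (lam - β) * ‖y‖ ^ 2 / 2)
            * ρ₁ (x - Real.sqrt (ℓ * σ) • y))
          * ((lam / (2 * Real.pi)) ^ ((d : ℝ) / 2)
              * Real.exp (-lam * ‖y‖ ^ 2 / 2))) ∂volume := by
  have hσ0 : 0 < σ := hσ.1
  have hc : 0 < Real.sqrt (ℓ * σ) := Real.sqrt_pos.2 (by positivity)
  have hc2 : Real.sqrt (ℓ * σ) ^ 2 = ℓ * σ := Real.sq_sqrt (by positivity)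
  set c := Real.sqrt (ℓ * σ)
  have hηint : Integrable η P :=
    ((memLp_two_iff_integrable_sq_norm hη.aestronglyMeasurable).2 hmom).integrable one_le_two
  obtain ⟨hshift, hshift_eq⟩ := integral_norm_sub_sq_of_integral_eq_zero hηint hmean hmom x
  let g : EuclideanSpace ℝ (Fin d) → ℝ := fun z =>
    β / (2 * ℓ) * ‖z‖ ^ 2 - β / (2 * ℓ * σ) * ‖x - z‖ ^ 2
  have hg : Measurable g := by fun_prop
  have hexp : Measurable fun z => ENNReal.ofReal (Real.exp (g z)) := by fun_prop
  have hgint : Integrable (fun ω => g (η ω)) P := (hmom.const_mul _).sub (hshift.const_mul _)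
  have hgmean : ∫ ω, g (η ω) ∂P =
      -β * (‖x‖ ^ 2 + β * ∫ ω, ‖η ω‖ ^ 2 ∂P) / (2 * ℓ * σ) := by
    simp only [g]
    rw [integral_sub (hmom.const_mul _) (hshift.const_mul _), integral_const_mul,
      integral_const_mul, hshift_eq]
    obtain rfl : β = 1 - σ := by linarith
    field_simp
    ring
  have hconst : (2 * Real.pi * ℓ * σ / lam) ^ (-(d : ℝ) / 2) =
      (lam / (2 * Real.pi)) ^ ((d : ℝ) / 2) * (c ^ d)⁻¹ := by
    have hcd : c ^ d = (ℓ * σ) ^ ((d : ℝ) / 2) := by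
      rw [← hc2, ← Real.rpow_natCast c 2, ← Real.rpow_mul hc.le, ← Real.rpow_natCast c d]
      congr 1
      push_cast
      ring
    rw [hcd, neg_div, Real.rpow_neg (by positivity), ← Real.inv_rpow (by positivity),
      ← Real.inv_rpow (by positivity), ← Real.mul_rpow (by positivity) (by positivity)]
    congr 1
    field_simp
  have hintegrand : ∀ y, (Real.exp (β * ‖x - c • y‖ ^ 2 / (2 * ℓ) + (lam - β) * ‖y‖ ^ 2 / 2)
        * ρ₁ (x - c • y)) * ((lam / (2 * Real.pi)) ^ ((d : ℝ) / 2)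
          * Real.exp (-lam * ‖y‖ ^ 2 / 2)) =
      (lam / (2 * Real.pi)) ^ ((d : ℝ) / 2) *
        (ρ₁ (x - c • y) * Real.exp (g (x - c • y))) := by
    intro y
    have hsplit : Real.exp (g (x - c • y)) =
        Real.exp (β * ‖x - c • y‖ ^ 2 / (2 * ℓ) + (lam - β) * ‖y‖ ^ 2 / 2) *
          Real.exp (-lam * ‖y‖ ^ 2 / 2) := by
      rw [← Real.exp_add]
      congr 1
      simp only [g]
      rw [sub_sub_cancel, norm_smul, mul_pow, Real.norm_eq_abs, sq_abs, hc2]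
      field_simp
      ring
    rw [hsplit]
    ring
  have hA : 0 ≤ (lam / (2 * Real.pi)) ^ ((d : ℝ) / 2) := by positivity
  have hexpect : ∫⁻ z, ENNReal.ofReal (ρ₁ z) * ENNReal.ofReal (Real.exp (g z)) =
      ∫⁻ ω, ENNReal.ofReal (Real.exp (g (η ω))) ∂P := by
    rw [← lintegral_map hexp hη, hlaw,
      lintegral_withDensity_eq_lintegral_mul _ hρmeas.ennreal_ofReal hexp]
    rfl
  have hcov := lintegral_comp_sub_smul volume
    (f := fun z => ENNReal.ofReal (ρ₁ z) * ENNReal.ofReal (Real.exp (g z)))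
    (hρmeas.ennreal_ofReal.mul hexp) x hc
  simp_rw [hintegrand, ENNReal.ofReal_mul hA, ENNReal.ofReal_mul (hρ0 _)]
  rw [lintegral_const_mul' _ _ ENNReal.ofReal_ne_top,
    hcov, hexpect,
    finrank_euclideanSpace_fin, hconst, ← hgmean, ENNReal.ofReal_mul (by positivity),
    ENNReal.ofReal_mul hA, mul_assoc]
  gcongr
  exact ofReal_exp_integral_le_lintegral hgint
end

section
/- Let p ≥ 1, let ρ₀ : ℝ^d → [0, ∞) be a probability density, let ν be a probability measure on ℝ^d, and let β, σ ∈ (0,1) with β + σ = 1, and σ' ∈ ℝ. Define ρ_σ(z) := σ^{−d} ρ₀(z/σ), φ(x) := ∫_{ℝ^d} ρ_σ(x − βy) ν(dy) and, on {φ > 0}, b(x) := σ' ∫_{ℝ^d} (x − y) ρ_σ(x − βy) ν(dy) / ( σ ∫_{ℝ^d} ρ_σ(x − βy) ν(dy) ). Then ∫_{ℝ^d} |b(x)|^p φ(x) dx ≤ |σ'|^p ∫_{ℝ^d} ∫_{ℝ^d} |z − y|^p ρ₀(z) dz ν(dy), as an inequality in [0, ∞]. -/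
open MeasureTheory
open scoped ENNReal

namespace MeasureTheory

/-- Weighted Jensen inequality in `[0, ∞]`. -/
theorem rpow_lintegral_mul_le {α : Type*} [MeasurableSpace α] {μ : Measure α}
    {f g : α → ℝ≥0∞} (hf : AEMeasurable f μ) (hg : AEMeasurable g μ) {p : ℝ} (hp : 1 ≤ p) :
    (∫⁻ a, f a * g a ∂μ) ^ p ≤ (∫⁻ a, f a ^ p * g a ∂μ) * (∫⁻ a, g a ∂μ) ^ (p - 1) := by
  have hp0 : 0 < p := by linarith
  have hinv : p⁻¹ ≤ 1 := inv_le_one_of_one_le₀ hp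
  have key := ENNReal.lintegral_mul_norm_pow_le ((hf.pow_const p).mul hg) hg
    (inv_nonneg.2 hp0.le) (sub_nonneg.2 hinv) (add_sub_cancel _ _)
  have hpt (a : α) : (f a ^ p * g a) ^ p⁻¹ * g a ^ (1 - p⁻¹) = f a * g a := by
    rw [ENNReal.mul_rpow_of_nonneg _ _ (inv_nonneg.2 hp0.le), ENNReal.rpow_rpow_inv hp0.ne',
      mul_assoc, ← ENNReal.rpow_add_of_nonneg _ _ (inv_nonneg.2 hp0.le) (sub_nonneg.2 hinv),
      add_sub_cancel, ENNReal.rpow_one]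
  simp only [Pi.mul_apply, hpt] at key
  calc (∫⁻ a, f a * g a ∂μ) ^ p
      ≤ ((∫⁻ a, f a ^ p * g a ∂μ) ^ p⁻¹ * (∫⁻ a, g a ∂μ) ^ (1 - p⁻¹)) ^ p :=
        ENNReal.rpow_le_rpow key hp0.le
    _ = (∫⁻ a, f a ^ p * g a ∂μ) * (∫⁻ a, g a ∂μ) ^ (p - 1) := by
        rw [ENNReal.mul_rpow_of_nonneg _ _ hp0.le, ENNReal.rpow_inv_rpow hp0.ne',
          ← ENNReal.rpow_mul, sub_mul, inv_mul_cancel₀ hp0.ne', one_mul]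

/-- Jensen inequality for `‖·‖ ^ p` and the barycenter of `f` with respect to a weight `g`. -/
theorem ofReal_norm_weighted_average_rpow_le {α E : Type*} [MeasurableSpace α] {μ : Measure α}
    [NormedAddCommGroup E] [NormedSpace ℝ E] {f : α → E} {g : α → ℝ}
    (hf : AEStronglyMeasurable f μ) (hg : Integrable g μ) (hg0 : ∀ a, 0 ≤ g a)
    (hpos : 0 < ∫ a, g a ∂μ) {p : ℝ} (hp : 1 ≤ p) :
    ENNReal.ofReal (‖(∫ a, g a ∂μ)⁻¹ • ∫ a, g a • f a ∂μ‖ ^ p * ∫ a, g a ∂μ)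
      ≤ ∫⁻ a, ENNReal.ofReal (‖f a‖ ^ p * g a) ∂μ := by
  have hp0 : 0 < p := by linarith
  set I := ∫ a, g a ∂μ with hI
  have hIG : ENNReal.ofReal I = ∫⁻ a, ENNReal.ofReal (g a) ∂μ :=
    ofReal_integral_eq_lintegral_ofReal hg (.of_forall hg0)
  have hI0 : ENNReal.ofReal I ≠ 0 := by simpa using hpos
  have hconv (v : E) {t : ℝ} : ENNReal.ofReal (‖v‖ ^ p * t) = ‖v‖ₑ ^ p * ENNReal.ofReal t := by
    rw [ENNReal.ofReal_mul (by positivity),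
      ← ENNReal.ofReal_rpow_of_nonneg (norm_nonneg _) hp0.le, ofReal_norm]
  have hnorm : ‖∫ a, g a • f a ∂μ‖ₑ ≤ ∫⁻ a, ‖f a‖ₑ * ENNReal.ofReal (g a) ∂μ := by
    refine (enorm_integral_le_lintegral_enorm _).trans_eq (lintegral_congr fun a => ?_)
    rw [enorm_smul, Real.enorm_of_nonneg (hg0 a), mul_comm]
  simp only [hconv]
  calc ‖I⁻¹ • ∫ a, g a • f a ∂μ‖ₑ ^ p * ENNReal.ofReal I
      = ‖∫ a, g a • f a ∂μ‖ₑ ^ p * ENNReal.ofReal I ^ (1 - p) := by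
        rw [enorm_smul, Real.enorm_of_nonneg (inv_nonneg.2 hpos.le),
          ENNReal.ofReal_inv_of_pos hpos, ENNReal.mul_rpow_of_nonneg _ _ hp0.le,
          ENNReal.inv_rpow, ← ENNReal.rpow_neg, sub_eq_neg_add,
          ENNReal.rpow_add _ _ hI0 ENNReal.ofReal_ne_top, ENNReal.rpow_one]
        ring
    _ ≤ (∫⁻ a, ‖f a‖ₑ ^ p * ENNReal.ofReal (g a) ∂μ) * ENNReal.ofReal I ^ (p - 1)
          * ENNReal.ofReal I ^ (1 - p) := by
        gcongr
        rw [hIG]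
        exact (ENNReal.rpow_le_rpow hnorm hp0.le).trans
          (rpow_lintegral_mul_le hf.enorm hg.aemeasurable.ennreal_ofReal hp)
    _ = ∫⁻ a, ‖f a‖ₑ ^ p * ENNReal.ofReal (g a) ∂μ := by
        rw [mul_assoc, ← ENNReal.rpow_add _ _ hI0 ENNReal.ofReal_ne_top]
        simp

/-- Affine change of variables for the Lebesgue integral of a `[0, ∞]`-valued function. -/
theorem lintegral_comp_smul_sub {E : Type*} [NormedAddCommGroup E] [NormedSpace ℝ E]
    [FiniteDimensional ℝ E] [MeasurableSpace E] [BorelSpace E] (μ : Measure E)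
    [μ.IsAddHaarMeasure] (f : E → ℝ≥0∞) {r : ℝ} (hr : r ≠ 0) (v : E) :
    ∫⁻ x, f (r • (x - v)) ∂μ
      = ENNReal.ofReal |(r ^ Module.finrank ℝ E)⁻¹| * ∫⁻ x, f x ∂μ := by
  rw [lintegral_sub_right_eq_self (fun x => f (r • x)) v,
    ← (measurableEmbedding_const_smul₀ hr).lintegral_map, Measure.map_addHaar_smul μ hr,
    lintegral_smul_measure, smul_eq_mul]

end MeasureTheory

/-- Jensen plus change of variables bound for the ODE drift: with `ρ_σ(z) = σ^{−d}ρ₀(z/σ)`,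
`φ(x) = ∫ ρ_σ(x−βy) ν(dy)` and `b(x) = σ'∫(x−y)ρ_σ(x−βy)ν(dy)/(σ∫ρ_σ(x−βy)ν(dy))` on
`{φ > 0}`, one has `∫|b(x)|^p φ(x) dx ≤ |σ'|^p ∫∫ |z−y|^p ρ₀(z) dz ν(dy)` in `[0,∞]`. -/
theorem drift_Lp_jensen_bound
    {d : ℕ} (p : ℝ) (hp : 1 ≤ p)
    (ρ₀ : EuclideanSpace ℝ (Fin d) → ℝ) (hρmeas : Measurable ρ₀) (hρ0 : ∀ z, 0 ≤ ρ₀ z)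
    (hρ1 : ∫ z, ρ₀ z ∂volume = 1)
    (ν : Measure (EuclideanSpace ℝ (Fin d))) [IsProbabilityMeasure ν]
    (β σ : ℝ) (hβ : β ∈ Set.Ioo (0 : ℝ) 1) (hσ : σ ∈ Set.Ioo (0 : ℝ) 1) (hβσ : β + σ = 1)
    (σ' : ℝ)
    (φ : EuclideanSpace ℝ (Fin d) → ℝ)
    (hφ : ∀ x, φ x = ∫ y, ρ₀ (σ⁻¹ • (x - β • y)) / σ ^ d ∂ν)
    (b : EuclideanSpace ℝ (Fin d) → EuclideanSpace ℝ (Fin d))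
    (hb : ∀ x, 0 < φ x → b x =
      (σ' / (σ * ∫ y, ρ₀ (σ⁻¹ • (x - β • y)) / σ ^ d ∂ν))
        • ∫ y, (ρ₀ (σ⁻¹ • (x - β • y)) / σ ^ d) • (x - y) ∂ν) :
    ∫⁻ x, ENNReal.ofReal (‖b x‖ ^ p * φ x) ∂volume
      ≤ ENNReal.ofReal (|σ'| ^ p)
          * ∫⁻ y, (∫⁻ z, ENNReal.ofReal (‖z - y‖ ^ p * ρ₀ z) ∂volume) ∂ν := by
  obtain ⟨hσ0, -⟩ := hσ
  have hp0 : 0 < p := by linarith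
  have hshift (x y : EuclideanSpace ℝ (Fin d)) :
      (σ' / σ) • (x - y) = σ' • (σ⁻¹ • (x - β • y) - y) := by
    have : σ⁻¹ • (x - β • y) - y = σ⁻¹ • (x - y) := by
      obtain rfl : β = 1 - σ := by linarith
      match_scalars <;> field_simp
      ring
    rw [this, smul_smul, div_eq_mul_inv]
  let H (y z : EuclideanSpace ℝ (Fin d)) : ℝ≥0∞ := ENNReal.ofReal (‖z - y‖ ^ p * ρ₀ z)
  let K (x y : EuclideanSpace ℝ (Fin d)) : ℝ≥0∞ :=
    ENNReal.ofReal (|σ'| ^ p) * (ENNReal.ofReal (σ ^ d)⁻¹ * H y (σ⁻¹ • (x - β • y)))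
  have hKmeas : Measurable (Function.uncurry K) := by
    unfold K H Function.uncurry
    fun_prop
  have hpt (x : EuclideanSpace ℝ (Fin d)) :
      ENNReal.ofReal (‖b x‖ ^ p * φ x) ≤ ∫⁻ y, K x y ∂ν := by
    rcases le_or_gt (φ x) 0 with h | h
    · rw [ENNReal.ofReal_of_nonpos (mul_nonpos_of_nonneg_of_nonpos (by positivity) h)]
      exact zero_le
    have hI := hφ x ▸ h
    have hbx : b x = (∫ y, ρ₀ (σ⁻¹ • (x - β • y)) / σ ^ d ∂ν)⁻¹ •
        ∫ y, (ρ₀ (σ⁻¹ • (x - β • y)) / σ ^ d) • ((σ' / σ) • (x - y)) ∂ν := by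
      rw [hb x h]
      simp_rw [smul_comm _ (σ' / σ)]
      rw [integral_smul, smul_smul]
      congr 1
      field_simp
    rw [hbx, hφ x]
    refine (ofReal_norm_weighted_average_rpow_le (by fun_prop)
      (not_imp_comm.1 integral_undef hI.ne') (fun y => div_nonneg (hρ0 _) (by positivity))
      hI hp).trans_eq (lintegral_congr fun y => ?_)
    simp only [K, H]
    rw [hshift, norm_smul, Real.norm_eq_abs, Real.mul_rpow (abs_nonneg _) (norm_nonneg _),
      ← ENNReal.ofReal_mul (by positivity), ← ENNReal.ofReal_mul (by positivity)]
    congr 1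
    ring
  calc ∫⁻ x, ENNReal.ofReal (‖b x‖ ^ p * φ x)
      ≤ ∫⁻ x, ∫⁻ y, K x y ∂ν := lintegral_mono hpt
    _ = ∫⁻ y, ∫⁻ x, K x y ∂volume ∂ν := lintegral_lintegral_swap hKmeas.aemeasurable
    _ = ∫⁻ y, ENNReal.ofReal (|σ'| ^ p) * ∫⁻ z, H y z ∂volume ∂ν := by
        refine lintegral_congr fun y => ?_
        rw [lintegral_const_mul' _ _ ENNReal.ofReal_ne_top,
          lintegral_const_mul' _ _ ENNReal.ofReal_ne_top,
          lintegral_comp_smul_sub volume (H y) (inv_ne_zero hσ0.ne') (β • y),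
          finrank_euclideanSpace_fin, ← mul_assoc (ENNReal.ofReal (σ ^ d)⁻¹),
          ← ENNReal.ofReal_mul (by positivity), inv_pow, inv_inv,
          abs_of_pos (pow_pos hσ0 d), inv_mul_cancel₀ (pow_pos hσ0 d).ne',
          ENNReal.ofReal_one, one_mul]
    _ = _ := lintegral_const_mul' _ _ ENNReal.ofReal_ne_top
end

section
/- Let p ≥ 1, and let ρ₀ ∈ C¹(ℝ^d) satisfy 0 < ρ₀(x) ≤ K and |∇ρ₀(x)| ≤ κ(1 + |x|)^{p−1} for all x, for some constants K, κ > 0. Let ν be a probability measure on ℝ^d with ∫ |y|^p ν(dy) < ∞, and let σ, β : [0,1] → [0,1] be C¹ functions with β_t = 1 − σ_t, σ₀ = 1, σ₁ = 0, and σ'_t < 0 for t ∈ [0,1). For t ∈ [0,1) define D_t(x) := ∫ y ρ₀((x − β_t y)/σ_t) ν(dy) / ∫ ρ₀((x − β_t y)/σ_t) ν(dy). Then for each t ∈ [0,1), x ↦ D_t(x) is differentiable, and for every t₀ ∈ (0,1) and R > 0, sup { ‖∇_x D_t(x)‖ : t ∈ [0, t₀], |x| ≤ R } < ∞. -/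
open MeasureTheory
open scoped ENNReal

section Drift

/-- A finite `p`-th moment makes `(1 + ‖y‖) ^ p` integrable. -/
lemma integrable_one_add_norm_rpow {E : Type*} [NormedAddCommGroup E] [MeasurableSpace E]
    [BorelSpace E] {ν : Measure E} [IsFiniteMeasure ν] {p : ℝ} (hp : 0 ≤ p)
    (hmom : ∫⁻ y, ENNReal.ofReal (‖y‖ ^ p) ∂ν < ∞) :
    Integrable (fun y : E => (1 + ‖y‖) ^ p) ν := by
  have hint : Integrable (fun y : E => ‖y‖ ^ p) ν := by
    refine ⟨(measurable_norm.pow_const p).aestronglyMeasurable, ?_⟩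
    rw [hasFiniteIntegral_iff_ofReal (Filter.Eventually.of_forall fun y => by positivity)]
    exact hmom
  refine (((integrable_const (1 : ℝ)).add hint).const_mul (2 ^ p)).mono'
    ((measurable_const.add measurable_norm).pow_const p).aestronglyMeasurable
    (Filter.Eventually.of_forall fun y => ?_)
  have hy : 0 ≤ ‖y‖ := norm_nonneg y
  rw [Real.norm_of_nonneg (by positivity)]
  have hmax : (max 1 ‖y‖) ^ p ≤ 1 + ‖y‖ ^ p := by
    have := Real.rpow_nonneg hy p
    rcases max_choice 1 ‖y‖ with h | h <;> rw [h]
    · simpa using this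
    · linarith
  calc (1 + ‖y‖) ^ p ≤ (2 * max 1 ‖y‖) ^ p := by
        gcongr
        linarith [le_max_left 1 ‖y‖, le_max_right 1 ‖y‖]
    _ = 2 ^ p * (max 1 ‖y‖) ^ p := Real.mul_rpow (by norm_num) (by positivity)
    _ ≤ 2 ^ p * (1 + ‖y‖ ^ p) := by gcongr

variable {E G : Type*} [NormedAddCommGroup E] [NormedSpace ℝ E]
  [NormedAddCommGroup G] [NormedSpace ℝ G]

/-- `‖s⁻¹ • (x - b • y)‖` grows at most linearly in `‖y‖`, uniformly in `x` and `s`. -/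
lemma norm_inv_smul_sub_smul_le {s₀ s b R : ℝ} (hs₀ : 0 < s₀) (hs : s₀ ≤ s)
    (hb : b ∈ Set.Icc (0 : ℝ) 1) {x : E} (hx : ‖x‖ ≤ R) (y : E) :
    ‖s⁻¹ • (x - b • y)‖ ≤ s₀⁻¹ * (R + ‖y‖) := by
  have hs_pos : 0 < s := hs₀.trans_le hs
  rw [norm_smul, norm_inv, Real.norm_of_nonneg hs_pos.le]
  have hsub : ‖x - b • y‖ ≤ R + ‖y‖ := by
    refine (norm_sub_le _ _).trans (add_le_add hx ?_)
    rw [norm_smul, Real.norm_of_nonneg hb.1]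
    exact mul_le_of_le_one_left (norm_nonneg y) hb.2
  gcongr

lemma norm_fderiv_rescaled_le {ρ : E → ℝ} {p κ : ℝ} (hp : 1 ≤ p) (hκ : 0 ≤ κ)
    (hgrad : ∀ x, ‖fderiv ℝ ρ x‖ ≤ κ * (1 + ‖x‖) ^ (p - 1))
    {s₀ s b R : ℝ} (hs₀ : 0 < s₀) (hs : s₀ ≤ s) (hb : b ∈ Set.Icc (0 : ℝ) 1)
    {x : E} (hx : ‖x‖ ≤ R) (y : E) :
    ‖s⁻¹ • fderiv ℝ ρ (s⁻¹ • (x - b • y))‖ ≤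
      s₀⁻¹ * (κ * (1 + s₀⁻¹ * (R + 1)) ^ (p - 1)) * (1 + ‖y‖) ^ (p - 1) := by
  have hs_pos : 0 < s := hs₀.trans_le hs
  have hR : 0 ≤ R := (norm_nonneg x).trans hx
  have hp' : 0 ≤ p - 1 := by linarith
  have hy : 0 ≤ ‖y‖ := norm_nonneg y
  have hlin : 1 + ‖s⁻¹ • (x - b • y)‖ ≤ (1 + s₀⁻¹ * (R + 1)) * (1 + ‖y‖) := by
    have h := norm_inv_smul_sub_smul_le hs₀ hs hb hx y
    have h' : 0 ≤ s₀⁻¹ * (R * ‖y‖) := by positivity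
    have h'' : 0 ≤ s₀⁻¹ := by positivity
    nlinarith
  rw [norm_smul, norm_inv, Real.norm_of_nonneg hs_pos.le, mul_assoc, mul_assoc,
    ← Real.mul_rpow (by positivity) (by positivity)]
  calc s⁻¹ * ‖fderiv ℝ ρ (s⁻¹ • (x - b • y))‖
      ≤ s₀⁻¹ * (κ * (1 + ‖s⁻¹ • (x - b • y)‖) ^ (p - 1)) := by
        gcongr
        exact hgrad _
    _ ≤ _ := by gcongr

lemma differentiableAt_inv_smul_and_norm_fderiv_le {Z : E → ℝ} {N : E → G} {Z' : E →L[ℝ] ℝ}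
    {N' : E →L[ℝ] G} {x : E} {c B C : ℝ} (hZ : HasFDerivAt Z Z' x) (hN : HasFDerivAt N N' x)
    (hc : 0 < c) (hcZ : c ≤ Z x) (hZ' : ‖Z'‖ ≤ B) (hN' : ‖N'‖ ≤ B) (hNx : ‖N x‖ ≤ C) :
    DifferentiableAt ℝ (fun x => (Z x)⁻¹ • N x) x ∧
      ‖fderiv ℝ (fun x => (Z x)⁻¹ • N x) x‖ ≤ c⁻¹ * B + (c ^ 2)⁻¹ * B * C := by
  have hZpos : 0 < Z x := hc.trans_le hcZ
  have hB : 0 ≤ B := (norm_nonneg _).trans hZ'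
  have hinv : HasFDerivAt (fun x => (Z x)⁻¹) ((-(Z x ^ 2)⁻¹) • Z') x :=
    (hasDerivAt_inv hZpos.ne').comp_hasFDerivAt x hZ
  have h := hinv.fun_smul hN
  refine ⟨h.differentiableAt, ?_⟩
  rw [h.fderiv]
  refine (norm_add_le _ _).trans ?_
  rw [ContinuousLinearMap.norm_smulRight_apply, norm_smul, norm_smul, norm_neg, norm_inv, norm_inv,
    norm_pow, Real.norm_of_nonneg hZpos.le]
  gcongr

variable [MeasurableSpace E] [BorelSpace E]

/-- Differentiation under the integral sign for a weighted rescaled density, with a bound on the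
value and on the derivative. -/
lemma exists_hasFDerivAt_integral_rescaled_smul [SecondCountableTopology E] {ρ : E → ℝ} {p K κ : ℝ}
    (hp : 1 ≤ p) (hκ : 0 ≤ κ) (hρ : ContDiff ℝ 1 ρ) (hρK : ∀ x, ‖ρ x‖ ≤ K)
    (hgrad : ∀ x, ‖fderiv ℝ ρ x‖ ≤ κ * (1 + ‖x‖) ^ (p - 1))
    {ν : Measure E} (hint : Integrable (fun y : E => (1 + ‖y‖) ^ p) ν)
    {g : E → G} (hg : Continuous g) (hg_le : ∀ y, ‖g y‖ ≤ 1 + ‖y‖)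
    {s₀ s b R : ℝ} (hs₀ : 0 < s₀) (hs : s₀ ≤ s) (hb : b ∈ Set.Icc (0 : ℝ) 1)
    {x : E} (hx : ‖x‖ ≤ R) :
    ‖∫ y, ρ (s⁻¹ • (x - b • y)) • g y ∂ν‖ ≤ K * ∫ y, (1 + ‖y‖) ^ p ∂ν ∧
    ∃ L : E →L[ℝ] G,
      HasFDerivAt (fun x => ∫ y, ρ (s⁻¹ • (x - b • y)) • g y ∂ν) L x ∧
      ‖L‖ ≤ s₀⁻¹ * (κ * (1 + s₀⁻¹ * (R + 1 + 1)) ^ (p - 1)) * ∫ y, (1 + ‖y‖) ^ p ∂ν := by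
  have hK : 0 ≤ K := (norm_nonneg _).trans (hρK 0)
  have hR : 0 ≤ R := (norm_nonneg x).trans hx
  set A := s₀⁻¹ * (κ * (1 + s₀⁻¹ * (R + 1 + 1)) ^ (p - 1)) with hA
  have hA0 : 0 ≤ A := by positivity
  have hval (x y : E) : ‖ρ (s⁻¹ • (x - b • y)) • g y‖ ≤ K * (1 + ‖y‖) ^ p := by
    rw [norm_smul]
    have : 1 + ‖y‖ ≤ (1 + ‖y‖) ^ p :=
      Real.self_le_rpow_of_one_le (by linarith [norm_nonneg y]) hp
    gcongr
    exacts [hρK _, (hg_le y).trans this]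
  have hcont (x : E) : Continuous fun y => ρ (s⁻¹ • (x - b • y)) • g y :=
    (hρ.continuous.comp (by fun_prop)).smul hg
  have hderiv_le : ∀ y, ∀ x' ∈ Metric.ball x 1,
      ‖(s⁻¹ • fderiv ℝ ρ (s⁻¹ • (x' - b • y))).smulRight (g y)‖ ≤ A * (1 + ‖y‖) ^ p := by
    intro y x' hx'
    have hx'R : ‖x'‖ ≤ R + 1 := by
      have h := norm_le_norm_add_norm_sub x x'
      rw [mem_ball_iff_norm, norm_sub_rev] at hx'
      linarith [norm_sub_rev x x']
    have hy : 0 < 1 + ‖y‖ := by positivity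
    rw [ContinuousLinearMap.norm_smulRight_apply]
    calc _ ≤ A * (1 + ‖y‖) ^ (p - 1) * (1 + ‖y‖) := by
          gcongr
          exacts [norm_fderiv_rescaled_le hp hκ hgrad hs₀ hs hb hx'R y, hg_le y]
      _ = A * (1 + ‖y‖) ^ p := by
          rw [mul_assoc, ← Real.rpow_add_one hy.ne', sub_add_cancel]
  refine ⟨?_, _, hasFDerivAt_integral_of_dominated_of_fderiv_le
    (F' := fun x y => (s⁻¹ • fderiv ℝ ρ (s⁻¹ • (x - b • y))).smulRight (g y))
    (bound := fun y => A * (1 + ‖y‖) ^ p) (Metric.ball_mem_nhds x one_pos)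
    (.of_forall fun x => (hcont x).aestronglyMeasurable) ?_ ?_ (.of_forall hderiv_le)
    (hint.const_mul A) (.of_forall fun y x' _ => ?_), ?_⟩
  · rw [← integral_const_mul]
    exact norm_integral_le_of_norm_le (hint.const_mul K) (.of_forall (hval x))
  · exact (hint.const_mul K).mono' (hcont x).aestronglyMeasurable (.of_forall (hval x))
  · have hfd : Continuous (fderiv ℝ ρ) := hρ.continuous_fderiv one_ne_zero
    have : SecondCountableTopologyEither E (E →L[ℝ] G) := ⟨.inl inferInstance⟩
    refine Continuous.aestronglyMeasurable ?_
    have h1 : Continuous fun y => s⁻¹ • fderiv ℝ ρ (s⁻¹ • (x - b • y)) := by fun_prop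
    exact (ContinuousLinearMap.smulRightL ℝ E G).continuous₂.comp (h1.prodMk hg)
  · refine HasFDerivAt.smul_const ?_ (g y)
    have hin : HasFDerivAt (fun x : E => s⁻¹ • (x - b • y))
        (s⁻¹ • ContinuousLinearMap.id ℝ E) x' :=
      ((hasFDerivAt_id x').sub_const _).const_smul _
    have hout := ((hρ.differentiable one_ne_zero) (s⁻¹ • (x' - b • y))).hasFDerivAt
    simpa [ContinuousLinearMap.comp_smul] using! hout.comp x' hin
  · rw [← integral_const_mul]
    exact norm_integral_le_of_norm_le (hint.const_mul A)
      (.of_forall fun y => hderiv_le y x (Metric.mem_ball_self one_pos))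

/-- The normalising integral is bounded below uniformly in `x` in a ball and in the rescaling. -/
lemma exists_pos_le_integral_rescaled [ProperSpace E] {ρ : E → ℝ} {K : ℝ} (hρ : Continuous ρ)
    (hρpos : ∀ x, 0 < ρ x) (hρK : ∀ x, ρ x ≤ K) (ν : Measure E) [IsProbabilityMeasure ν]
    {s₀ : ℝ} (hs₀ : 0 < s₀) (R : ℝ) :
    ∃ c > 0, ∀ s, s₀ ≤ s → ∀ b ∈ Set.Icc (0 : ℝ) 1, ∀ x : E, ‖x‖ ≤ R →
      c ≤ ∫ y, ρ (s⁻¹ • (x - b • y)) ∂ν := by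
  obtain ⟨n, hn⟩ : ∃ n : ℕ, ν (Metric.closedBall (0 : E) n) ≠ 0 := by
    by_contra! h
    have := measure_iUnion_null h
    rw [Metric.iUnion_closedBall_nat] at this
    simp at this
  obtain ⟨m, hm, hm_le⟩ : ∃ m > 0, ∀ z ∈ Metric.closedBall (0 : E) (s₀⁻¹ * (R + n)), m ≤ ρ z :=
    (isCompact_closedBall _ _).exists_forall_le' hρ.continuousOn fun z _ => hρpos z
  refine ⟨ν.real (Metric.closedBall (0 : E) n) * m,
    mul_pos (ENNReal.toReal_pos hn (measure_ne_top _ _)) hm, fun s hs b hb x hx => ?_⟩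
  have hint : Integrable (fun y => ρ (s⁻¹ • (x - b • y))) ν :=
    (integrable_const K).mono' (hρ.comp (by fun_prop)).aestronglyMeasurable
      (.of_forall fun y => by rw [Real.norm_of_nonneg (hρpos _).le]; exact hρK _)
  rw [← smul_eq_mul, ← integral_indicator_const m measurableSet_closedBall]
  refine integral_mono ((integrable_const m).indicator measurableSet_closedBall) hint fun y => ?_
  refine Set.indicator_apply_le' (fun hy => hm_le _ ?_) fun _ => (hρpos _).le
  rw [mem_closedBall_zero_iff] at hy ⊢
  refine (norm_inv_smul_sub_smul_le hs₀ hs hb hx y).trans ?_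
  gcongr

/-- The normalised weighted mean is differentiable with gradient bounded on balls, uniformly in the
rescaling. -/
lemma exists_norm_fderiv_rescaled_mean_le [ProperSpace E] {ρ : E → ℝ} {p K κ : ℝ}
    (hp : 1 ≤ p) (hκ : 0 ≤ κ) (hρ : ContDiff ℝ 1 ρ)
    (hρpos : ∀ x, 0 < ρ x) (hρK : ∀ x, ρ x ≤ K)
    (hgrad : ∀ x, ‖fderiv ℝ ρ x‖ ≤ κ * (1 + ‖x‖) ^ (p - 1))
    (ν : Measure E) [IsProbabilityMeasure ν]
    (hmom : ∫⁻ y, ENNReal.ofReal (‖y‖ ^ p) ∂ν < ∞) {s₀ : ℝ} (hs₀ : 0 < s₀) (R : ℝ) :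
    ∃ M : ℝ, ∀ s, s₀ ≤ s → ∀ b ∈ Set.Icc (0 : ℝ) 1, ∀ x : E, ‖x‖ ≤ R →
      DifferentiableAt ℝ (fun x => (∫ y, ρ (s⁻¹ • (x - b • y)) ∂ν)⁻¹
        • ∫ y, ρ (s⁻¹ • (x - b • y)) • y ∂ν) x ∧
      ‖fderiv ℝ (fun x => (∫ y, ρ (s⁻¹ • (x - b • y)) ∂ν)⁻¹
        • ∫ y, ρ (s⁻¹ • (x - b • y)) • y ∂ν) x‖ ≤ M := by
  obtain ⟨c, hc, hcle⟩ := exists_pos_le_integral_rescaled hρ.continuous hρpos hρK ν hs₀ R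
  have hint := integrable_one_add_norm_rpow (by linarith) hmom
  have hρK' (x : E) : ‖ρ x‖ ≤ K := by
    rw [Real.norm_of_nonneg (hρpos x).le]
    exact hρK x
  set B := s₀⁻¹ * (κ * (1 + s₀⁻¹ * (R + 1 + 1)) ^ (p - 1)) * ∫ y, (1 + ‖y‖) ^ p ∂ν
  refine ⟨c⁻¹ * B + (c ^ 2)⁻¹ * B * (K * ∫ y, (1 + ‖y‖) ^ p ∂ν), fun s hs b hb x hx => ?_⟩
  obtain ⟨-, Z', hZ, hZ'⟩ := exists_hasFDerivAt_integral_rescaled_smul hp hκ hρ hρK' hgrad hint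
    (g := fun _ => (1 : ℝ)) continuous_const (fun y => by simp) hs₀ hs hb hx
  obtain ⟨hNx, N', hN, hN'⟩ := exists_hasFDerivAt_integral_rescaled_smul hp hκ hρ hρK' hgrad hint
    (g := fun y : E => y) continuous_id (fun y => by simp) hs₀ hs hb hx
  simp only [smul_eq_mul, mul_one] at hZ
  exact differentiableAt_inv_smul_and_norm_fderiv_le hZ hN hc (hcle s hs b hb x hx) hZ' hN' hNx

end Drift

/-- Local gradient bounds for the ODE drift component
`D_t(x) = ∫ y ρ₀((x−β_ty)/σ_t) ν(dy) / ∫ ρ₀((x−β_ty)/σ_t) ν(dy)` when `ρ₀ ∈ C¹` is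
positive, bounded, with `|∇ρ₀(x)| ≤ κ(1+|x|)^{p−1}`, and `∫|y|^p ν(dy) < ∞`:
each `D_t` is differentiable and `∇ₓD_t(x)` is bounded uniformly over `t ∈ [0, t₀]`,
`|x| ≤ R`. -/
theorem ode_drift_gradient_locally_bounded
    {d : ℕ} (p : ℝ) (hp : 1 ≤ p)
    (ρ₀ : EuclideanSpace ℝ (Fin d) → ℝ) (hρC1 : ContDiff ℝ 1 ρ₀)
    (K κ : ℝ) (hK : 0 < K) (hκ : 0 < κ)
    (hρpos : ∀ x, 0 < ρ₀ x) (hρle : ∀ x, ρ₀ x ≤ K)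
    (hgrad : ∀ x, ‖gradient ρ₀ x‖ ≤ κ * (1 + ‖x‖) ^ (p - 1))
    (ν : Measure (EuclideanSpace ℝ (Fin d))) [IsProbabilityMeasure ν]
    (hmom : ∫⁻ y, ENNReal.ofReal (‖y‖ ^ p) ∂ν < ∞)
    (σ β : ℝ → ℝ)
    (hσC1 : ContDiffOn ℝ 1 σ (Set.Icc 0 1))
    (hσmem : ∀ t ∈ Set.Icc (0 : ℝ) 1, σ t ∈ Set.Icc (0 : ℝ) 1)
    (hβmem : ∀ t ∈ Set.Icc (0 : ℝ) 1, β t ∈ Set.Icc (0 : ℝ) 1)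
    (hβσ : ∀ t ∈ Set.Icc (0 : ℝ) 1, β t = 1 - σ t)
    (hσ0 : σ 0 = 1) (hσ1 : σ 1 = 0)
    (hσ' : ∀ t ∈ Set.Ico (0 : ℝ) 1, derivWithin σ (Set.Icc 0 1) t < 0)
    (D : ℝ → EuclideanSpace ℝ (Fin d) → EuclideanSpace ℝ (Fin d))
    (hD : ∀ t ∈ Set.Ico (0 : ℝ) 1, ∀ x, D t x =
      (∫ y, ρ₀ ((σ t)⁻¹ • (x - β t • y)) ∂ν)⁻¹
        • ∫ y, ρ₀ ((σ t)⁻¹ • (x - β t • y)) • y ∂ν) :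
    (∀ t ∈ Set.Ico (0 : ℝ) 1, ∀ x, DifferentiableAt ℝ (D t) x) ∧
      ∀ t₀ ∈ Set.Ioo (0 : ℝ) 1, ∀ R : ℝ, 0 < R →
        ∃ M : ℝ, ∀ t ∈ Set.Icc (0 : ℝ) t₀, ∀ x : EuclideanSpace ℝ (Fin d),
          ‖x‖ ≤ R → ‖fderiv ℝ (D t) x‖ ≤ M := by
  have hanti : StrictAntiOn σ (Set.Icc 0 1) := by
    refine strictAntiOn_of_deriv_neg (convex_Icc 0 1) hσC1.continuousOn fun t ht => ?_
    rw [interior_Icc] at ht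
    rw [← derivWithin_of_mem_nhds (Icc_mem_nhds ht.1 ht.2)]
    exact hσ' t ⟨ht.1.le, ht.2⟩
  have hσpos : ∀ t ∈ Set.Ico (0 : ℝ) 1, 0 < σ t := fun t ht =>
    hσ1 ▸ hanti ⟨ht.1, ht.2.le⟩ (Set.right_mem_Icc.2 zero_le_one) ht.2
  have hgrad' : ∀ x, ‖fderiv ℝ ρ₀ x‖ ≤ κ * (1 + ‖x‖) ^ (p - 1) := fun x => by
    rw [← toDual_gradient, LinearIsometryEquiv.norm_map]
    exact hgrad x
  have hbound {s₀ : ℝ} (hs₀ : 0 < s₀) (R : ℝ) :=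
    exists_norm_fderiv_rescaled_mean_le hp hκ.le hρC1 hρpos hρle hgrad' ν hmom hs₀ R
  refine ⟨fun t ht x => ?_, fun t₀ ht₀ R _ => ?_⟩
  · obtain ⟨M, hM⟩ := hbound (hσpos t ht) ‖x‖
    rw [funext (hD t ht)]
    exact (hM _ le_rfl _ (hβmem t ⟨ht.1, ht.2.le⟩) x le_rfl).1
  · obtain ⟨M, hM⟩ := hbound (hσpos t₀ ⟨ht₀.1.le, ht₀.2⟩) R
    refine ⟨M, fun t ht x hx => ?_⟩
    have ht1 : t ∈ Set.Ico (0 : ℝ) 1 := ⟨ht.1, ht.2.trans_lt ht₀.2⟩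
    have ht1' : t ∈ Set.Icc (0 : ℝ) 1 := ⟨ht1.1, ht1.2.le⟩
    rw [funext (hD t ht1)]
    exact (hM _ (hanti.antitoneOn ht1' ⟨ht₀.1.le, ht₀.2.le⟩ ht.2) _ (hβmem t ht1') x hx).2
end

section
/- Let K > 0, N ∈ ℕ, and y₁, …, y_N ∈ ℝ^d with |y_i| ≤ K for all i. Let β, σ ∈ (0,1) with β + σ = 1, let ℓ > 0 and β' > 0, and set σ' := −β'. Define 𝒞(x, y) := e^{−|x − βy|²/(2ℓσ)} and b(x) := σ' Σ_{i=1}^N (x − y_i) 𝒞(x, y_i) / ( σ Σ_{i=1}^N 𝒞(x, y_i) ). Then b is differentiable on ℝ^d and satisfies the one-sided bound ⟨z, ∇b(x) z⟩ ≤ (β'/σ) ( K²/(ℓσ) − 1 ) |z|² for all x, z ∈ ℝ^d. -/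
open MeasureTheory
open scoped ENNReal RealInnerProductSpace

section GaussianMean

variable {E : Type*} [NormedAddCommGroup E] [InnerProductSpace ℝ E]

/-- The derivative of an unnormalised isotropic Gaussian centred at `a`. -/
theorem hasFDerivAt_exp_neg_norm_sub_sq_div (a x : E) (c : ℝ) :
    HasFDerivAt (fun u : E => Real.exp (-‖u - a‖ ^ 2 / (2 * c)))
      ((-Real.exp (-‖x - a‖ ^ 2 / (2 * c)) / c) • innerSL ℝ (x - a)) x := by
  have h : HasFDerivAt (fun u : E => -‖u - a‖ ^ 2 / (2 * c))
      ((-c⁻¹) • innerSL ℝ (x - a)) x := by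
    have h₁ := (((hasFDerivAt_id x).sub_const a).norm_sq).const_mul (-(2 * c)⁻¹)
    refine (h₁.congr_fderiv ?_).congr_of_eventuallyEq (.of_forall fun u => ?_)
    · ext z
      simp
      ring
    · simp only [id]
      ring
  refine h.exp.congr_fderiv ?_
  rw [smul_smul]
  congr 1
  ring

/-- The derivative of a mean of the points `y i` with differentiable weights `w i`. -/
theorem hasFDerivAt_inv_sum_smul_sum_smul {ι : Type*} [Fintype ι] (y : ι → E)
    {w : ι → E → ℝ} {w' : ι → E →L[ℝ] ℝ} {x : E} (hw : ∀ i, HasFDerivAt (w i) (w' i) x)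
    (hx : ∑ i, w i x ≠ 0) :
    HasFDerivAt (fun u => (∑ i, w i u)⁻¹ • ∑ i, w i u • y i)
      ((∑ i, w i x)⁻¹ • ∑ i, (w' i).smulRight (y i) +
        ((-((∑ i, w i x) ^ 2)⁻¹) • ∑ i, w' i).smulRight (∑ i, w i x • y i)) x := by
  have hS : HasFDerivAt (fun u => ∑ i, w i u) (∑ i, w' i) x :=
    HasFDerivAt.fun_sum fun i _ => hw i
  have hM : HasFDerivAt (fun u => ∑ i, w i u • y i) (∑ i, (w' i).smulRight (y i)) x :=
    HasFDerivAt.fun_sum fun i _ => (hw i).smul_const (y i)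
  exact ((hasDerivAt_inv hx).comp_hasFDerivAt x hS).smul hM

/-- The mean of points `y i` in a ball of radius `K`, weighted by Gaussians centred at `β • y i`
of variance `c`, is differentiable with derivative `Dm` satisfying
`⟪z, Dm(x) z⟫ ≤ β K² / c * ‖z‖²`: the left-hand side is
`β / c` times the variance of `⟪y i, z⟫`. -/
theorem exists_hasFDerivAt_gaussian_mean_inner_le {ι : Type*} [Fintype ι] [Nonempty ι]
    (y : ι → E) {K β c : ℝ} (hy : ∀ i, ‖y i‖ ≤ K) (hβ : 0 ≤ β) (hc : 0 < c) (x : E) :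
    ∃ m' : E →L[ℝ] E,
      HasFDerivAt (fun u => (∑ i, Real.exp (-‖u - β • y i‖ ^ 2 / (2 * c)))⁻¹ •
        ∑ i, Real.exp (-‖u - β • y i‖ ^ 2 / (2 * c)) • y i) m' x ∧
      ∀ z, ⟪z, m' z⟫ ≤ β * K ^ 2 / c * ‖z‖ ^ 2 := by
  have hpos : 0 < ∑ i, Real.exp (-‖x - β • y i‖ ^ 2 / (2 * c)) :=
    Finset.sum_pos (fun i _ => Real.exp_pos _) Finset.univ_nonempty
  refine ⟨_, hasFDerivAt_inv_sum_smul_sum_smul y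
    (fun i => hasFDerivAt_exp_neg_norm_sub_sq_div (β • y i) x c) hpos.ne', fun z => ?_⟩
  have hwpos : ∀ i, 0 < Real.exp (-‖x - β • y i‖ ^ 2 / (2 * c)) := fun i => Real.exp_pos _
  generalize hw : (fun i => Real.exp (-‖x - β • y i‖ ^ 2 / (2 * c))) = w at *
  have hw' : ∀ i, Real.exp (-‖x - β • y i‖ ^ 2 / (2 * c)) = w i := fun i => congrFun hw i
  simp only [hw'] at hpos hwpos ⊢
  set S := ∑ i, w i with hS
  set A := ∑ i, w i * ⟪y i, z⟫ with hA
  set B := ∑ i, w i * ⟪y i, z⟫ ^ 2 with hB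
  have hgrad : ∑ i, -w i / c * ⟪x - β • y i, z⟫ = -(⟪x, z⟫ * S - β * A) / c := by
    rw [hS, hA, Finset.mul_sum, Finset.mul_sum, ← Finset.sum_sub_distrib, ← Finset.sum_neg_distrib,
      Finset.sum_div]
    refine Finset.sum_congr rfl fun i _ => ?_
    rw [inner_sub_left, real_inner_smul_left]
    ring
  have hcross : ∑ i, -w i / c * ⟪x - β • y i, z⟫ * ⟪y i, z⟫ = -(⟪x, z⟫ * A - β * B) / c := by
    rw [hA, hB, Finset.mul_sum, Finset.mul_sum, ← Finset.sum_sub_distrib, ← Finset.sum_neg_distrib,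
      Finset.sum_div]
    refine Finset.sum_congr rfl fun i _ => ?_
    rw [inner_sub_left, real_inner_smul_left]
    ring
  have hmean : ⟪z, ∑ i, w i • y i⟫ = A := by
    simp only [hA, inner_sum, real_inner_smul_right, real_inner_comm]
  have hvar : ⟪z, (S⁻¹ • ∑ i, ((-w i / c) • innerSL ℝ (x - β • y i)).smulRight (y i) +
      ((-(S ^ 2)⁻¹) • ∑ i, (-w i / c) • innerSL ℝ (x - β • y i)).smulRight
        (∑ i, w i • y i)) z⟫ = β / c * (B / S - (A / S) ^ 2) := by
    simp only [add_apply, smul_apply,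
      sum_apply, ContinuousLinearMap.smulRight_apply, innerSL_apply_apply,
      inner_add_right, real_inner_smul_right, inner_sum, smul_eq_mul] at hmean ⊢
    rw [hmean, hgrad]
    simp only [real_inner_comm _ z] at hcross ⊢
    rw [hcross]
    field_simp
    ring
  have hBle : B ≤ K ^ 2 * ‖z‖ ^ 2 * S := by
    rw [hB, hS, Finset.mul_sum]
    refine Finset.sum_le_sum fun i _ => ?_
    rw [mul_comm]
    refine mul_le_mul_of_nonneg_right ?_ (hwpos i).le
    rw [← mul_pow, ← sq_abs]
    gcongr
    exact (abs_real_inner_le_norm _ _).trans (by gcongr; exact hy i)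
  rw [hvar]
  calc β / c * (B / S - (A / S) ^ 2) ≤ β / c * (K ^ 2 * ‖z‖ ^ 2) := by
        gcongr
        linarith [(div_le_iff₀ hpos).2 hBle, sq_nonneg (A / S)]
    _ = β * K ^ 2 / c * ‖z‖ ^ 2 := by ring

end GaussianMean

/-- One-sided Lipschitz (dissipativity) bound for the empirical zero-order drift
`b(x) = σ' Σᵢ(x−yᵢ)𝒞(x,yᵢ)/(σ Σᵢ𝒞(x,yᵢ))` with `𝒞(x,y) = e^{−|x−βy|²/(2ℓσ)}`,
when `|yᵢ| ≤ K`: `b` is differentiable and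
`⟨z, ∇b(x)z⟩ ≤ (β'/σ)(K²/(ℓσ) − 1)|z|²` for all `x, z`. -/
theorem empirical_drift_one_sided_bound
    {d : ℕ} (K : ℝ) (hK : 0 < K) (N : ℕ) (hN : 0 < N)
    (y : Fin N → EuclideanSpace ℝ (Fin d)) (hy : ∀ i, ‖y i‖ ≤ K)
    (β σ : ℝ) (hβ : β ∈ Set.Ioo (0 : ℝ) 1) (hσ : σ ∈ Set.Ioo (0 : ℝ) 1) (hβσ : β + σ = 1)
    (ℓ : ℝ) (hℓ : 0 < ℓ) (β' : ℝ) (hβ' : 0 < β') (σ' : ℝ) (hσ' : σ' = -β')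
    (b : EuclideanSpace ℝ (Fin d) → EuclideanSpace ℝ (Fin d))
    (hb : ∀ x, b x =
      (σ' / (σ * ∑ i : Fin N, Real.exp (-‖x - β • y i‖ ^ 2 / (2 * ℓ * σ))))
        • ∑ i : Fin N, Real.exp (-‖x - β • y i‖ ^ 2 / (2 * ℓ * σ)) • (x - y i)) :
    ∀ x : EuclideanSpace ℝ (Fin d), DifferentiableAt ℝ b x ∧
      ∀ z : EuclideanSpace ℝ (Fin d),
        ⟪z, fderiv ℝ b x z⟫ ≤ β' / σ * (K ^ 2 / (ℓ * σ) - 1) * ‖z‖ ^ 2 := by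
  obtain ⟨hσ0, -⟩ := hσ
  obtain ⟨hβ0, hβ1⟩ := hβ
  have : Nonempty (Fin N) := ⟨⟨0, hN⟩⟩
  have hb' : b = fun u => (σ' / σ) • (u -
      (∑ i, Real.exp (-‖u - β • y i‖ ^ 2 / (2 * (ℓ * σ))))⁻¹ •
        ∑ i, Real.exp (-‖u - β • y i‖ ^ 2 / (2 * (ℓ * σ))) • y i) := by
    funext u
    have hpos : 0 < ∑ i, Real.exp (-‖u - β • y i‖ ^ 2 / (2 * (ℓ * σ))) :=
      Finset.sum_pos (fun i _ => Real.exp_pos _) Finset.univ_nonempty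
    rw [hb]
    simp only [mul_assoc, smul_sub, Finset.sum_sub_distrib, ← Finset.sum_smul, smul_smul]
    congr 2 <;> field_simp
  intro x
  obtain ⟨m', hm, hle⟩ :=
    exists_hasFDerivAt_gaussian_mean_inner_le y hy hβ0.le (mul_pos hℓ hσ0) x
  have hder : HasFDerivAt b ((σ' / σ) • (ContinuousLinearMap.id ℝ _ - m')) x := by
    rw [hb']
    exact ((hasFDerivAt_id x).sub hm).const_smul (σ' / σ)
  refine ⟨hder.differentiableAt, fun z => ?_⟩
  have hz : ⟪z, m' z⟫ ≤ K ^ 2 / (ℓ * σ) * ‖z‖ ^ 2 := by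
    refine (hle z).trans ?_
    gcongr
    exact mul_le_of_le_one_left (sq_nonneg K) hβ1.le
  rw [hder.fderiv]
  simp only [smul_apply, sub_apply,
    ContinuousLinearMap.id_apply, real_inner_smul_right, inner_sub_right,
    real_inner_self_eq_norm_sq, hσ']
  calc -β' / σ * (‖z‖ ^ 2 - ⟪z, m' z⟫) = β' / σ * (⟪z, m' z⟫ - ‖z‖ ^ 2) := by ring
    _ ≤ β' / σ * (K ^ 2 / (ℓ * σ) * ‖z‖ ^ 2 - ‖z‖ ^ 2) := by gcongr
    _ = β' / σ * (K ^ 2 / (ℓ * σ) - 1) * ‖z‖ ^ 2 := by ring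
end

section
/- Let σ, β : [0,1] → [0,1] be C¹ functions with β_t = 1 − σ_t, σ₀ = 1, σ₁ = 0, and σ'_t < 0 for t ∈ [0,1). Let ε, γ, κ > 0 and set ℓ_s := εβ_s + γσ_s. Then for every t ∈ [0,1), ∫₀ᵗ (β'_s / σ_s²) e^{κ β_s² / (ℓ_s σ_s)} ds ≤ (ε/κ) ( e^{κ β_t / (ε σ_t)} − 1 ). -/
open MeasureTheory intervalIntegral
open scoped ENNReal

/-- A continuous function on `[0, 1]` with negative derivative on `[0, 1)` and value `0` at `1`
is positive on `[0, 1)`. -/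
theorem pos_of_derivWithin_neg_of_apply_one_eq_zero {σ : ℝ → ℝ}
    (hσ : ContinuousOn σ (Set.Icc 0 1)) (hσ1 : σ 1 = 0)
    (hσ' : ∀ t ∈ Set.Ico (0 : ℝ) 1, derivWithin σ (Set.Icc 0 1) t < 0)
    {s : ℝ} (hs : s ∈ Set.Ico (0 : ℝ) 1) : 0 < σ s := by
  have hanti : StrictAntiOn σ (Set.Icc 0 1) := by
    refine strictAntiOn_of_deriv_neg (convex_Icc 0 1) hσ fun x hx => ?_
    rw [interior_Icc] at hx
    rw [← derivWithin_of_mem_nhds (Icc_mem_nhds hx.1 hx.2)]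
    exact hσ' x (Set.Ioo_subset_Ico_self hx)
  rw [← hσ1]
  exact hanti (Set.Ico_subset_Icc_self hs) (Set.right_mem_Icc.2 zero_le_one) hs.2

/-- The exponent `κ b² / ((ε b + γ a) a)` is at most `κ b / (ε a)`. -/
theorem weighted_exponent_le {a b ε γ κ : ℝ} (ha : 0 < a) (hb : 0 ≤ b) (hε : 0 < ε)
    (hγ : 0 < γ) (hκ : 0 < κ) :
    κ * b ^ 2 / ((ε * b + γ * a) * a) ≤ κ * b / (ε * a) := by
  rw [div_le_div_iff₀ (by positivity) (by positivity)]
  have h : 0 ≤ κ * b * a * (γ * a) := by positivity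
  linarith

/-- Gaussian-weighted error accumulation bound: for `C¹` schedules with `β_t = 1 − σ_t`,
`σ₀ = 1`, `σ₁ = 0`, `σ'_t < 0` on `[0,1)`, `ε, γ, κ > 0` and `ℓ_s = εβ_s + γσ_s`,
`∫₀ᵗ (β'_s/σ_s²) e^{κβ_s²/(ℓ_sσ_s)} ds ≤ (ε/κ)(e^{κβ_t/(εσ_t)} − 1)` for `t ∈ [0,1)`. -/
theorem weighted_error_accumulation_bound
    (σ β : ℝ → ℝ)
    (hσC1 : ContDiffOn ℝ 1 σ (Set.Icc 0 1))
    (hσmem : ∀ t ∈ Set.Icc (0 : ℝ) 1, σ t ∈ Set.Icc (0 : ℝ) 1)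
    (hβmem : ∀ t ∈ Set.Icc (0 : ℝ) 1, β t ∈ Set.Icc (0 : ℝ) 1)
    (hβσ : ∀ t ∈ Set.Icc (0 : ℝ) 1, β t = 1 - σ t)
    (hσ0 : σ 0 = 1) (hσ1 : σ 1 = 0)
    (hσ' : ∀ t ∈ Set.Ico (0 : ℝ) 1, derivWithin σ (Set.Icc 0 1) t < 0)
    (ε γ κ : ℝ) (hε : 0 < ε) (hγ : 0 < γ) (hκ : 0 < κ)
    (t : ℝ) (ht : t ∈ Set.Ico (0 : ℝ) 1) :
    (∫ s in (0 : ℝ)..t,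
        derivWithin β (Set.Icc 0 1) s / (σ s) ^ 2
          * Real.exp (κ * (β s) ^ 2 / ((ε * β s + γ * σ s) * σ s)))
      ≤ ε / κ * (Real.exp (κ * β t / (ε * σ t)) - 1) := by
  have hcσ : ContinuousOn σ (Set.Icc 0 1) := hσC1.continuousOn
  have hβC1 : ContDiffOn ℝ 1 β (Set.Icc 0 1) := (contDiffOn_const.sub hσC1).congr hβσ
  have hdβ : ContinuousOn (derivWithin β (Set.Icc 0 1)) (Set.Icc 0 1) :=
    hβC1.continuousOn_derivWithin (uniqueDiffOn_Icc zero_lt_one) le_rfl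
  have hβ' : ∀ s ∈ Set.Icc (0 : ℝ) 1,
      derivWithin β (Set.Icc 0 1) s = -derivWithin σ (Set.Icc 0 1) s := fun s hs => by
    rw [derivWithin_congr hβσ (hβσ s hs), derivWithin_const_sub]
  have hIco : Set.Icc 0 t ⊆ Set.Ico (0 : ℝ) 1 := fun s hs => ⟨hs.1, hs.2.trans_lt ht.2⟩
  have hIcc : Set.Icc 0 t ⊆ Set.Icc (0 : ℝ) 1 := hIco.trans Set.Ico_subset_Icc_self
  have hσpos : ∀ s ∈ Set.Icc 0 t, 0 < σ s := fun s hs =>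
    pos_of_derivWithin_neg_of_apply_one_eq_zero hcσ hσ1 hσ' (hIco hs)
  have hβnn : ∀ s ∈ Set.Icc 0 t, 0 ≤ β s := fun s hs => (hβmem s (hIcc hs)).1
  have hcσt := hcσ.mono hIcc
  have hcβt := hβC1.continuousOn.mono hIcc
  have hweight : ContinuousOn (fun s => derivWithin β (Set.Icc 0 1) s / (σ s) ^ 2)
      (Set.Icc 0 t) :=
    (hdβ.mono hIcc).div (hcσt.pow 2) fun s hs => (pow_pos (hσpos s hs) 2).ne'
  have hexp : ContinuousOn (fun s => Real.exp (κ * β s / (ε * σ s))) (Set.Icc 0 t) :=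
    ((continuousOn_const.mul hcβt).div (continuousOn_const.mul hcσt)
      fun s hs => (mul_pos hε (hσpos s hs)).ne').rexp
  have hexp' : ContinuousOn
      (fun s => Real.exp (κ * (β s) ^ 2 / ((ε * β s + γ * σ s) * σ s))) (Set.Icc 0 t) := by
    refine ((continuousOn_const.mul (hcβt.pow 2)).div
      (((continuousOn_const.mul hcβt).add (continuousOn_const.mul hcσt)).mul hcσt)
      fun s hs => ?_).rexp
    have h1 := hσpos s hs
    have h2 := hβnn s hs
    have h3 : 0 < (ε * β s + γ * σ s) * σ s := by positivity
    exact h3.ne'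
  have hint := (hweight.mul hexp).intervalIntegrable_of_Icc (μ := volume) ht.1
  have hint' := (hweight.mul hexp').intervalIntegrable_of_Icc (μ := volume) ht.1
  have hderiv : ∀ s ∈ Set.Ioo 0 t,
      HasDerivAt (fun s => ε / κ * Real.exp (κ * β s / (ε * σ s)))
        (derivWithin β (Set.Icc 0 1) s / (σ s) ^ 2 * Real.exp (κ * β s / (ε * σ s))) s := by
    intro s hs
    have hst := Set.Ioo_subset_Icc_self hs
    have hnhds : Set.Icc (0 : ℝ) 1 ∈ nhds s := Icc_mem_nhds hs.1 (hs.2.trans ht.2)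
    have hσd : HasDerivAt σ (derivWithin σ (Set.Icc 0 1) s) s :=
      ((hσC1.differentiableOn one_ne_zero s (hIcc hst)).hasDerivWithinAt).hasDerivAt hnhds
    have hβd : HasDerivAt β (derivWithin β (Set.Icc 0 1) s) s :=
      ((hβC1.differentiableOn one_ne_zero s (hIcc hst)).hasDerivWithinAt).hasDerivAt hnhds
    have hpos := hσpos s hst
    refine ((((hβd.const_mul κ).fun_div (hσd.const_mul ε)
      (mul_pos hε hpos).ne').exp).const_mul (ε / κ)).congr_deriv ?_
    rw [hβ' s (hIcc hst), hβσ s (hIcc hst)]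
    field_simp
    ring
  have hβ0 : β 0 = 0 := by rw [hβσ 0 (Set.left_mem_Icc.2 zero_le_one), hσ0, sub_self]
  calc
    _ ≤ ∫ s in (0 : ℝ)..t,
        derivWithin β (Set.Icc 0 1) s / (σ s) ^ 2 * Real.exp (κ * β s / (ε * σ s)) := by
      refine integral_mono_on ht.1 hint' hint fun s hs => ?_
      refine mul_le_mul_of_nonneg_left (Real.exp_le_exp.2
        (weighted_exponent_le (hσpos s hs) (hβnn s hs) hε hγ hκ)) (div_nonneg ?_ (sq_nonneg _))
      rw [hβ' s (hIcc hs)]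
      exact (neg_pos.2 (hσ' s (hIco hs))).le
    _ = ε / κ * (Real.exp (κ * β t / (ε * σ t)) - 1) := by
      rw [integral_eq_sub_of_hasDerivAt_of_le ht.1 (continuousOn_const.mul hexp) hderiv hint]
      simp [hβ0, mul_sub]
end
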